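/- arXiv:2310.02132 — 4 statements merged into one kernel-verified Lean document; each statement's English description precedes it below -/
import Mathlib

section
/- Let n ≥ 1 and let K ⊂ ℂⁿ be a compact set that is convex with respect to principal hypersurfaces. Then for every ε > 0 and every bounded open set V with K ⊆ V, there exists a smooth function u : ℂⁿ → ℝ such that: (a) H_u(x)(w) ≥ 4‖w‖² for every x ∈ ℂⁿ ∖ V and every w ∈ ℂⁿ; (b) u is pluriharmonic on an open neighborhood of K; (c) H_u(x)(w) ≥ −4ε‖w‖² for every x ∈ V and every w ∈ ℂⁿ. -/
open Complex MeasureTheory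

/-- The Levi quadratic form of a real-valued function on ℂⁿ:
`H_u(x)(w) = D²u(x)(w,w) + D²u(x)(iw,iw)`. -/
noncomputable def leviForm {n : ℕ} (φ : EuclideanSpace ℂ (Fin n) → ℝ)
    (x w : EuclideanSpace ℂ (Fin n)) : ℝ :=
  iteratedFDeriv ℝ 2 φ x ![w, w] +
    iteratedFDeriv ℝ 2 φ x ![Complex.I • w, Complex.I • w]

/-- A compact set `K ⊆ ℂⁿ` is convex with respect to principal hypersurfaces if every point
outside `K` is separated from `K` by the zero set of an entire function. -/
def PrincipalConvex {n : ℕ} (K : Set (EuclideanSpace ℂ (Fin n))) : Prop :=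
  ∀ a ∉ K, ∃ f : EuclideanSpace ℂ (Fin n) → ℂ,
    Differentiable ℂ f ∧ f a = 0 ∧ ∀ z ∈ K, f z ≠ 0


open Metric Set Filter Topology
open scoped ContDiff

section Osgood

variable {E : Type*} [NormedAddCommGroup E] [NormedSpace ℂ E]

theorem hasDerivAt_comp_add_smul {f : E → ℂ} (hf : Differentiable ℂ f) (x v : E) (ζ : ℂ) :
    HasDerivAt (fun ζ : ℂ => f (x + ζ • v)) (fderiv ℂ f (x + ζ • v) v) ζ := by
  have h : HasDerivAt (fun ζ : ℂ => x + ζ • v) v ζ := by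
    simpa using ((hasDerivAt_id ζ).smul_const v).const_add x
  exact (hf (x + ζ • v)).hasFDerivAt.comp_hasDerivAt ζ h

theorem norm_fderiv_le_of_forall_mem_closedBall {f : E → ℂ} (hf : Differentiable ℂ f) {y : E}
    {M : ℝ} (hM : ∀ z ∈ closedBall y 1, ‖f z‖ ≤ M) : ‖fderiv ℂ f y‖ ≤ M := by
  have hM0 : 0 ≤ M := (norm_nonneg _).trans (hM y (mem_closedBall_self zero_le_one))
  refine ContinuousLinearMap.opNorm_le_bound _ hM0 fun v => ?_
  rcases eq_or_ne v 0 with rfl | hv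
  · simp
  have hv' : 0 < ‖v‖ := norm_pos_iff.2 hv
  have hd := hasDerivAt_comp_add_smul hf y v
  have h0 := (hd 0).deriv
  simp only [zero_smul, add_zero] at h0
  rw [← h0]
  have := norm_deriv_le_of_forall_mem_sphere_norm_le (c := 0) (R := ‖v‖⁻¹) (C := M)
    (f := fun ζ : ℂ => f (y + ζ • v)) (inv_pos.2 hv')
    (Differentiable.diffContOnCl fun ζ => (hd ζ).differentiableAt) (fun ζ hζ => hM _ ?_)
  · simpa using this
  · have : ‖ζ‖ = ‖v‖⁻¹ := by simpa using hζ
    simp [norm_smul, this, hv'.ne']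

theorem fderiv_apply_eq_circleIntegral {f : E → ℂ} (hf : Differentiable ℂ f) (x v : E) :
    fderiv ℂ f x v =
      (2 * Real.pi * I : ℂ)⁻¹ • ∮ ζ in C(0, 1), (ζ ^ 2)⁻¹ • f (x + ζ • v) := by
  have hd := hasDerivAt_comp_add_smul hf x v
  have h0 := (hd 0).deriv
  simp only [zero_smul, add_zero] at h0
  have := Complex.cderiv_eq_deriv (f := fun ζ : ℂ => f (x + ζ • v)) (z := 0) (r := 1) isOpen_univ
    (fun ζ _ => (hd ζ).differentiableAt.differentiableWithinAt) one_pos (subset_univ _)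
  rw [← h0, ← this, Complex.cderiv]
  simp

theorem Differentiable.fderiv_apply_complex [FiniteDimensional ℂ E] {f : E → ℂ}
    (hf : Differentiable ℂ f) (v : E) : Differentiable ℂ fun x => fderiv ℂ f x v := by
  intro x₀
  have : ProperSpace E := FiniteDimensional.proper ℂ E
  have : ProperSpace (E →L[ℂ] ℂ) := FiniteDimensional.proper ℂ _
  borelize E
  simp only [fderiv_apply_eq_circleIntegral hf _ v]
  refine DifferentiableAt.fun_const_smul (R := ℂ) ?_ (2 * Real.pi * I : ℂ)⁻¹
  simp only [circleIntegral]
  set c : ℝ → ℂ := fun θ => _root_.deriv (circleMap 0 1) θ * (circleMap 0 1 θ ^ 2)⁻¹ with hc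
  have hcc : Continuous c := by
    simp only [hc, deriv_circleMap]
    have : ∀ θ, circleMap 0 1 θ ^ 2 ≠ 0 := fun θ => by simp
    fun_prop (disch := simpa using this)
  have hcn : ∀ θ, ‖c θ‖ = 1 := fun θ => by simp [hc]
  obtain ⟨M, hM⟩ := (isCompact_closedBall x₀ (‖v‖ + 2)).exists_bound_of_continuousOn
    hf.continuous.continuousOn
  have hpath : Continuous fun θ : ℝ => x₀ + circleMap 0 1 θ • v := by fun_prop
  have key := intervalIntegral.hasFDerivAt_integral_of_dominated_of_fderiv_le (𝕜 := ℂ)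
    (μ := volume) (a := 0) (b := 2 * Real.pi) (x₀ := x₀) (s := ball x₀ 1)
    (F := fun x θ => c θ • f (x + circleMap 0 1 θ • v))
    (F' := fun x θ => c θ • fderiv ℂ f (x + circleMap 0 1 θ • v))
    (bound := fun _ => M) (ball_mem_nhds _ one_pos) ?_ ?_ ?_ ?_ ?_ ?_
  · simpa only [hc, mul_assoc, smul_eq_mul] using key.differentiableAt
  · refine Eventually.of_forall fun x => Continuous.aestronglyMeasurable ?_
    have := hf.continuous
    fun_prop
  · refine Continuous.intervalIntegrable ?_ _ _
    have := hf.continuous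
    fun_prop
  · exact (hcc.measurable.smul
      ((measurable_fderiv ℂ f).comp hpath.measurable)).aestronglyMeasurable
  · refine Eventually.of_forall fun θ _ x hx => ?_
    rw [norm_smul, hcn, one_mul]
    refine norm_fderiv_le_of_forall_mem_closedBall hf fun z hz => hM z ?_
    rw [mem_ball, dist_eq_norm] at hx
    rw [mem_closedBall, dist_eq_norm] at hz ⊢
    have e : z - x₀ = (z - (x + circleMap 0 1 θ • v)) + (x - x₀) + circleMap 0 1 θ • v := by abel
    have h3 : ‖circleMap 0 1 θ • v‖ = ‖v‖ := by simp [norm_smul]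
    rw [e]
    refine norm_add₃_le.trans ?_
    linarith
  · exact intervalIntegrable_const
  · refine Eventually.of_forall fun θ _ x _ => ?_
    have h : HasFDerivAt (fun x : E => x + circleMap 0 1 θ • v) (ContinuousLinearMap.id ℂ E) x :=
      (hasFDerivAt_id x).add_const _
    exact ((hf _).hasFDerivAt.comp x h).const_smul (c θ)

theorem Differentiable.contDiff_complex [FiniteDimensional ℂ E] {f : E → ℂ}
    (hf : Differentiable ℂ f) : ContDiff ℂ ∞ f := by
  refine contDiff_infty.2 fun n => ?_
  induction n generalizing f with
  | zero => exact contDiff_zero.2 hf.continuous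
  | succ n ih =>
    push_cast
    exact contDiff_succ_iff_fderiv_apply.2
      ⟨hf, fun h => by simp at h, fun v => ih (hf.fderiv_apply_complex v)⟩

end Osgood

section SmoothProfiles

theorem exists_contDiff_deriv_eq {k : ℝ → ℝ} (hk : ContDiff ℝ ∞ k) :
    ∃ G : ℝ → ℝ, ContDiff ℝ ∞ G ∧ deriv G = k := by
  have h : ∀ s, HasDerivAt (fun s => ∫ t in (0 : ℝ)..s, k t) (k s) s := fun s =>
    hk.continuous.integral_hasStrictDerivAt 0 s |>.hasDerivAt
  have h' : deriv (fun s => ∫ t in (0 : ℝ)..s, k t) = k := funext fun s => (h s).deriv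
  exact ⟨_, contDiff_infty_iff_deriv.2 ⟨fun s => (h s).differentiableAt, by rwa [h']⟩, h'⟩

theorem contDiff_smoothTransition_sub (a : ℝ) :
    ContDiff ℝ ∞ fun s => Real.smoothTransition (s - a) :=
  Real.smoothTransition.contDiff.comp (contDiff_id.sub contDiff_const)

theorem monotone_smoothTransition_sub (a : ℝ) :
    Monotone fun s => Real.smoothTransition (s - a) := fun _ _ h =>
  Real.smoothTransition.monotone (sub_le_sub_right h a)

theorem exists_convex_cutoff (a : ℝ) :
    ∃ G : ℝ → ℝ, ContDiff ℝ ∞ G ∧ (∀ s, 0 ≤ deriv G s) ∧ (∀ s, 0 ≤ deriv (deriv G) s) ∧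
      (∀ s < a, deriv G s = 0 ∧ deriv (deriv G) s = 0) ∧ ∀ s, a + 1 ≤ s → deriv G s = 1 := by
  obtain ⟨G, hG, hG'⟩ := exists_contDiff_deriv_eq (contDiff_smoothTransition_sub a)
  refine ⟨G, hG, fun s => ?_, fun s => ?_, fun s hs => ⟨?_, ?_⟩, fun s hs => ?_⟩
  · rw [hG']
    exact Real.smoothTransition.nonneg _
  · rw [hG']
    exact (monotone_smoothTransition_sub a).deriv_nonneg
  · rw [hG']
    exact Real.smoothTransition.zero_of_nonpos (by linarith)
  · rw [hG']
    have : (fun s => Real.smoothTransition (s - a)) =ᶠ[𝓝 s] fun _ => 0 := by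
      filter_upwards [Iio_mem_nhds hs] with t ht
      exact Real.smoothTransition.zero_of_nonpos (sub_nonpos.2 (le_of_lt ht))
    simp [this.deriv_eq]
  · rw [hG']
    exact Real.smoothTransition.one_of_one_le (by linarith)

/-- A smooth radial profile `G` for which `ζ ↦ G (‖ζ‖ ^ 2)` is subharmonic on `ℂ`, harmonic for
`2 < ‖ζ‖ ^ 2` and strictly subharmonic somewhere. -/
theorem exists_radial_subharmonic_profile :
    ∃ G : ℝ → ℝ, ContDiff ℝ ∞ G ∧ (∀ s, 0 ≤ deriv G s + s * deriv (deriv G) s) ∧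
      (∀ s, 2 < s → deriv G s + s * deriv (deriv G) s = 0) ∧
      ∃ c : ℝ, 0 < c ∧ 0 < deriv G (c ^ 2) + c ^ 2 * deriv (deriv G) (c ^ 2) := by
  set m : ℝ → ℝ := fun s => Real.smoothTransition (s - 1) with hm
  have hmc : ContDiff ℝ ∞ m := contDiff_smoothTransition_sub 1
  have hm0 : ∀ s ≤ 1, m s = 0 := fun s hs =>
    Real.smoothTransition.zero_of_nonpos (sub_nonpos.2 hs)
  have hm1 : ∀ s, 2 ≤ s → m s = 1 := fun s hs =>
    Real.smoothTransition.one_of_one_le (by linarith)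
  have hkc : ContDiff ℝ ∞ fun s => m s * s⁻¹ := by
    refine contDiff_iff_contDiffAt.2 fun s => ?_
    rcases lt_or_ge s 1 with hs | hs
    · have : (fun s => m s * s⁻¹) =ᶠ[𝓝 s] fun _ => 0 := by
        filter_upwards [Iio_mem_nhds hs] with t ht
        rw [hm0 t (le_of_lt ht), zero_mul]
      exact contDiffAt_const.congr_of_eventuallyEq this
    · exact hmc.contDiffAt.mul (contDiffAt_inv ℝ (by linarith))
  obtain ⟨G, hG, hG'⟩ := exists_contDiff_deriv_eq hkc
  have hsk : ∀ s, s * deriv G s = m s := fun s => by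
    rw [hG']
    rcases eq_or_ne s 0 with rfl | hs
    · simp [hm0 0 zero_le_one]
    · field_simp
  have hdk : Differentiable ℝ (deriv G) := by
    rw [hG']
    exact hkc.differentiable (by simp)
  have hkey : ∀ s, deriv G s + s * deriv (deriv G) s = deriv m s := fun s => by
    have h1 := (hasDerivAt_id s).mul (hdk s).hasDerivAt
    have h2 : (id * deriv G) = m := funext hsk
    rw [h2] at h1
    simpa using h1.deriv.symm
  refine ⟨G, hG, fun s => ?_, fun s hs => ?_, ?_⟩
  · rw [hkey]
    exact (monotone_smoothTransition_sub 1).deriv_nonneg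
  · rw [hkey]
    have : m =ᶠ[𝓝 s] fun _ => 1 := by
      filter_upwards [Ioi_mem_nhds hs] with t ht
      exact hm1 t (le_of_lt ht)
    simp [this.deriv_eq]
  · obtain ⟨s, hs, hs'⟩ := exists_deriv_eq_slope m one_lt_two hmc.continuous.continuousOn
      (hmc.differentiable (by simp)).differentiableOn
    have hs0 : 0 < s := lt_trans one_pos hs.1
    refine ⟨√s, Real.sqrt_pos.2 hs0, ?_⟩
    rw [Real.sq_sqrt hs0.le, hkey, hs', hm1 2 le_rfl, hm0 1 le_rfl]
    norm_num

end SmoothProfiles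

section SecondDerivative

variable {F : Type*} [NormedAddCommGroup F] [NormedSpace ℝ F]

theorem fderiv_fderiv_apply_eq_of_hasDerivAt {u : F → ℝ} (hu : ContDiff ℝ ∞ u) {x w : F}
    {g : ℝ → ℝ} {a : ℝ} (hg : ∀ t : ℝ, HasDerivAt (fun t : ℝ => u (x + t • w)) (g t) t)
    (ha : HasDerivAt g a 0) :
    fderiv ℝ (fderiv ℝ u) x w w = a := by
  have hl : ∀ t : ℝ, HasDerivAt (fun t : ℝ => x + t • w) w t := fun t => by
    simpa using ((hasDerivAt_id t).smul_const w).const_add x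
  have hd1 : Differentiable ℝ u := hu.differentiable (by simp)
  have hd2 : Differentiable ℝ (fderiv ℝ u) :=
    (hu.fderiv_right (m := ∞) (by simp)).differentiable (by simp)
  have h1 : ∀ t, g t = fderiv ℝ u (x + t • w) w := fun t =>
    (hg t).unique ((hd1 (x + t • w)).hasFDerivAt.comp_hasDerivAt t (hl t))
  have hx : HasFDerivAt (fderiv ℝ u) (fderiv ℝ (fderiv ℝ u) x) (x + (0 : ℝ) • w) := by
    simpa using (hd2 x).hasFDerivAt
  have h2 : HasDerivAt (fun t : ℝ => fderiv ℝ u (x + t • w)) (fderiv ℝ (fderiv ℝ u) x w) 0 :=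
    hx.comp_hasDerivAt 0 (hl 0)
  have h3 : HasDerivAt (fun t : ℝ => fderiv ℝ u (x + t • w) w)
      (fderiv ℝ (fderiv ℝ u) x w w) 0 := by
    simpa using h2.clm_apply (hasDerivAt_const 0 w)
  exact h3.unique (ha.congr_of_eventuallyEq (Eventually.of_forall fun t => (h1 t).symm))

theorem fderiv_fderiv_comp_apply {G : ℝ → ℝ} {p : F → ℝ} (hG : ContDiff ℝ ∞ G)
    (hp : ContDiff ℝ ∞ p) (x w : F) :
    fderiv ℝ (fderiv ℝ fun z => G (p z)) x w w =
      deriv (deriv G) (p x) * fderiv ℝ p x w ^ 2 +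
        deriv G (p x) * fderiv ℝ (fderiv ℝ p) x w w := by
  have hp1 : Differentiable ℝ p := hp.differentiable (by simp)
  have hp2 : Differentiable ℝ (fderiv ℝ p) :=
    (hp.fderiv_right (m := ∞) (by simp)).differentiable (by simp)
  have hG1 : Differentiable ℝ G := hG.differentiable (by simp)
  have hG2 : Differentiable ℝ (deriv G) :=
    (contDiff_infty_iff_deriv.1 hG).2.differentiable (by simp)
  have h1 : (fderiv ℝ fun z => G (p z)) = fun z => deriv G (p z) • fderiv ℝ p z := funext fun z =>
    ((hG1 (p z)).hasDerivAt.comp_hasFDerivAt z (hp1 z).hasFDerivAt).fderiv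
  have h2 : HasFDerivAt (fun z => deriv G (p z)) (deriv (deriv G) (p x) • fderiv ℝ p x) x :=
    (hG2 (p x)).hasDerivAt.comp_hasFDerivAt x (hp1 x).hasFDerivAt
  rw [h1, (h2.fun_smul (hp2 x).hasFDerivAt).fderiv]
  simp
  ring

end SecondDerivative

section LeviForm

variable {n : ℕ}

local notation "ℂ^" n => EuclideanSpace ℂ (Fin n)

theorem leviForm_eq_fderiv (u : (ℂ^n) → ℝ) (x w : ℂ^n) :
    leviForm u x w = fderiv ℝ (fderiv ℝ u) x w w +
      fderiv ℝ (fderiv ℝ u) x (I • w) (I • w) := by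
  simp [leviForm, iteratedFDeriv_two_apply]

theorem leviForm_smul_right (u : (ℂ^n) → ℝ) (x w : ℂ^n) (t : ℝ) :
    leviForm u x (t • w) = t ^ 2 * leviForm u x w := by
  simp only [leviForm_eq_fderiv, smul_comm I t w, map_smul, _root_.smul_apply,
    smul_eq_mul]
  ring

theorem leviForm_zero (x w : ℂ^n) : leviForm (fun _ => 0) x w = 0 := by
  simp [leviForm_eq_fderiv]

theorem leviForm_add {u v : (ℂ^n) → ℝ} (hu : ContDiff ℝ ∞ u) (hv : ContDiff ℝ ∞ v) (x w : ℂ^n) :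
    leviForm (fun z => u z + v z) x w = leviForm u x w + leviForm v x w := by
  have h := iteratedFDeriv_add_apply (x := x) (i := 2) (𝕜 := ℝ)
    (contDiff_infty.1 hu 2).contDiffAt (contDiff_infty.1 hv 2).contDiffAt
  have e : (fun z => u z + v z) = u + v := rfl
  simp only [leviForm, e, h, _root_.add_apply]
  ring

theorem leviForm_const_mul {u : (ℂ^n) → ℝ} (hu : ContDiff ℝ ∞ u) (c : ℝ) (x w : ℂ^n) :
    leviForm (fun z => c * u z) x w = c * leviForm u x w := by
  have h := iteratedFDeriv_const_smul_apply (x := x) (i := 2) (𝕜 := ℝ) (a := c)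
    (contDiff_infty.1 hu 2).contDiffAt
  have e : (fun z => c * u z) = c • u := rfl
  simp only [leviForm, e, h, _root_.smul_apply, smul_eq_mul]
  ring

theorem continuous_leviForm {u : (ℂ^n) → ℝ} (hu : ContDiff ℝ ∞ u) :
    Continuous fun p : (ℂ^n) × (ℂ^n) => leviForm u p.1 p.2 := by
  have h : Continuous (fderiv ℝ (fderiv ℝ u)) :=
    (hu.fderiv_right (m := ∞) (by simp)).continuous_fderiv (by simp)
  simp only [leviForm_eq_fderiv]
  fun_prop

theorem leviForm_comp {G : ℝ → ℝ} {p : (ℂ^n) → ℝ} (hG : ContDiff ℝ ∞ G) (hp : ContDiff ℝ ∞ p)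
    (x w : ℂ^n) :
    leviForm (fun z => G (p z)) x w =
      deriv (deriv G) (p x) * (fderiv ℝ p x w ^ 2 + fderiv ℝ p x (I • w) ^ 2) +
        deriv G (p x) * leviForm p x w := by
  simp only [leviForm_eq_fderiv, fderiv_fderiv_comp_apply hG hp]
  ring

theorem leviForm_norm_sq (x w : ℂ^n) : leviForm (fun z => ‖z‖ ^ 2) x w = 4 * ‖w‖ ^ 2 := by
  have h : ∀ v : ℂ^n, fderiv ℝ (fderiv ℝ fun z : ℂ^n => ‖z‖ ^ 2) x v v = 2 * ‖v‖ ^ 2 := fun v => by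
    have hl : ∀ t : ℝ, HasDerivAt (fun t : ℝ => x + t • v) v t := fun t => by
      simpa using ((hasDerivAt_id t).smul_const v).const_add x
    refine fderiv_fderiv_apply_eq_of_hasDerivAt (contDiff_norm_sq ℝ) (fun t => (hl t).norm_sq) ?_
    simpa using ((hl 0).inner ℝ (hasDerivAt_const 0 v)).const_mul 2
  rw [leviForm_eq_fderiv, h, h, norm_smul, Complex.norm_I]
  ring

theorem contDiff_norm_sq_comp {f : (ℂ^n) → ℂ} (hf : Differentiable ℂ f) :
    ContDiff ℝ ∞ fun z => ‖f z‖ ^ 2 :=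
  (hf.contDiff_complex.restrict_scalars ℝ).norm_sq ℝ

theorem hasDerivAt_norm_sq_comp {f : (ℂ^n) → ℂ} (hf : Differentiable ℂ f) (x v : ℂ^n) (t : ℝ) :
    HasDerivAt (fun t : ℝ => ‖f (x + t • v)‖ ^ 2)
      (2 * inner ℝ (f (x + t • v)) (fderiv ℂ f (x + t • v) v)) t :=
  (hasDerivAt_comp_add_smul hf x v t).comp_ofReal.norm_sq

theorem fderiv_norm_sq_comp_apply {f : (ℂ^n) → ℂ} (hf : Differentiable ℂ f) (x v : ℂ^n) :
    fderiv ℝ (fun z => ‖f z‖ ^ 2) x v = 2 * inner ℝ (f x) (fderiv ℂ f x v) := by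
  have hl : HasDerivAt (fun t : ℝ => x + t • v) v 0 := by
    simpa using ((hasDerivAt_id (0 : ℝ)).smul_const v).const_add x
  have h := (((contDiff_norm_sq_comp hf).differentiable (by simp))
    (x + (0 : ℝ) • v)).hasFDerivAt.comp_hasDerivAt 0 hl
  simpa using h.unique (hasDerivAt_norm_sq_comp hf x v 0)

theorem leviForm_norm_sq_comp {f : (ℂ^n) → ℂ} (hf : Differentiable ℂ f) (x w : ℂ^n) :
    leviForm (fun z => ‖f z‖ ^ 2) x w = 4 * ‖fderiv ℂ f x w‖ ^ 2 := by
  have h : ∀ v : ℂ^n, fderiv ℝ (fderiv ℝ fun z => ‖f z‖ ^ 2) x v v =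
      2 * (inner ℝ (f x) (fderiv ℂ (fun z => fderiv ℂ f z v) x v) +
        ‖fderiv ℂ f x v‖ ^ 2) := fun v => by
    refine fderiv_fderiv_apply_eq_of_hasDerivAt (contDiff_norm_sq_comp hf)
      (hasDerivAt_norm_sq_comp hf x v) ?_
    have h1 := (hasDerivAt_comp_add_smul hf x v (0 : ℝ)).comp_ofReal
    have h2 := (hasDerivAt_comp_add_smul (hf.fderiv_apply_complex v) x v (0 : ℝ)).comp_ofReal
    simpa using (h1.inner ℝ h2).const_mul 2
  have hI : fderiv ℂ (fun z => fderiv ℂ f z (I • w)) x (I • w) =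
      -fderiv ℂ (fun z => fderiv ℂ f z w) x w := by
    have e : (fun z => fderiv ℂ f z (I • w)) = fun z => I • fderiv ℂ f z w := by simp
    rw [e, fderiv_fun_const_smul (hf.fderiv_apply_complex w x)]
    simp [← mul_assoc]
  rw [leviForm_eq_fderiv, h, h, hI, map_smul, norm_smul, Complex.norm_I, inner_neg_right]
  ring

theorem leviForm_radial_comp {G : ℝ → ℝ} (hG : ContDiff ℝ ∞ G) {f : (ℂ^n) → ℂ}
    (hf : Differentiable ℂ f) (x w : ℂ^n) :
    leviForm (fun z => G (‖f z‖ ^ 2)) x w =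
      4 * ‖fderiv ℂ f x w‖ ^ 2 *
        (deriv G (‖f x‖ ^ 2) + ‖f x‖ ^ 2 * deriv (deriv G) (‖f x‖ ^ 2)) := by
  have h : ∀ a b : ℂ, inner ℝ a b ^ 2 + inner ℝ a (I * b) ^ 2 = ‖a‖ ^ 2 * ‖b‖ ^ 2 := fun a b => by
    rw [← Complex.normSq_eq_norm_sq, ← Complex.normSq_eq_norm_sq, Complex.inner, Complex.inner,
      Complex.normSq_apply, Complex.normSq_apply]
    simp
    ring
  rw [leviForm_comp hG (contDiff_norm_sq_comp hf), leviForm_norm_sq_comp hf,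
    fderiv_norm_sq_comp_apply hf, fderiv_norm_sq_comp_apply hf, map_smul, smul_eq_mul, mul_pow,
    mul_pow, ← mul_add, h]
  ring

theorem exists_differentiable_fderiv_apply_ne_zero {K : Set (ℂ^n)} (hKc : IsCompact K)
    {f : (ℂ^n) → ℂ} (hf : Differentiable ℂ f) {a w : ℂ^n} (hfa : f a = 0)
    (hfK : ∀ z ∈ K, f z ≠ 0) (hw : w ≠ 0) {c : ℝ} (hc : 0 < c) :
    ∃ F : (ℂ^n) → ℂ, Differentiable ℂ F ∧ ‖F a‖ = c ∧ fderiv ℂ F a w ≠ 0 ∧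
      ∀ z ∈ K, 2 ≤ ‖F z‖ := by
  have hq : ContinuousOn (fun z => (‖w‖ * ‖z - a‖ + c + 2) / ‖f z‖) K := by
    have := hf.continuous
    refine ContinuousOn.div (by fun_prop) (by fun_prop) fun z hz => norm_ne_zero_iff.2 (hfK z hz)
  obtain ⟨B, hB⟩ := hKc.exists_bound_of_continuousOn hq
  set A : ℝ := |B| + 1
  have hA : 0 < A := by positivity
  have hAf : ∀ z ∈ K, ‖w‖ * ‖z - a‖ + c + 2 ≤ A * ‖f z‖ := fun z hz => by
    rw [← div_le_iff₀ (norm_pos_iff.2 (hfK z hz))]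
    have h1 := (le_abs_self _).trans (hB z hz)
    have h2 := le_abs_self B
    simp only [A]
    linarith
  obtain ⟨s, hs, hs'⟩ : ∃ s : ℂ, ‖s‖ ≤ 1 ∧ (A : ℂ) * fderiv ℂ f a w + s * inner ℂ w w ≠ 0 := by
    by_cases h : fderiv ℂ f a w = 0
    · exact ⟨1, by simp, by simpa [h] using hw⟩
    · exact ⟨0, by simp, by simp [h, hA.ne']⟩
  have hF : ∀ z, HasFDerivAt (fun z => (A : ℂ) * f z + s * innerSL ℂ w (z - a) - c)
      ((A : ℂ) • fderiv ℂ f z + s • innerSL ℂ w) z := fun z =>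
    (((hf z).hasFDerivAt.const_mul (A : ℂ)).add
      (((innerSL ℂ w).hasFDerivAt.comp z ((hasFDerivAt_id z).sub_const a)).const_mul s)).sub_const _
  refine ⟨_, fun z => (hF z).differentiableAt, ?_, ?_, fun z hz => ?_⟩
  · simp [hfa, abs_of_pos hc]
  · rw [(hF a).fderiv]
    simpa using hs'
  · have h1 : ‖s * innerSL ℂ w (z - a)‖ ≤ ‖w‖ * ‖z - a‖ := by
      rw [norm_mul]
      refine (mul_le_of_le_one_left (norm_nonneg _) hs).trans ?_
      exact norm_inner_le_norm w (z - a)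
    have h2 : ‖(A : ℂ) * f z‖ = A * ‖f z‖ := by simp [abs_of_pos hA]
    have h3 : ‖(c : ℂ)‖ = c := by simp [abs_of_pos hc]
    have h4 := norm_sub_norm_le ((A : ℂ) * f z) (c - s * innerSL ℂ w (z - a))
    have h5 := norm_sub_le (c : ℂ) (s * innerSL ℂ w (z - a))
    have e : (A : ℂ) * f z - (c - s * innerSL ℂ w (z - a)) =
      (A : ℂ) * f z + s * innerSL ℂ w (z - a) - c := by ring
    rw [e] at h4
    linarith [hAf z hz]

/-- Smooth plurisubharmonic functions on `ℂⁿ` which are pluriharmonic near `K`. -/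
def IsPshPluriharmonicNear (K : Set (ℂ^n)) (u : (ℂ^n) → ℝ) : Prop :=
  ContDiff ℝ ∞ u ∧ (∀ x w, 0 ≤ leviForm u x w) ∧
    ∃ N, IsOpen N ∧ K ⊆ N ∧ ∀ x ∈ N, ∀ w, leviForm u x w = 0

theorem IsPshPluriharmonicNear.zero (K : Set (ℂ^n)) :
    IsPshPluriharmonicNear K fun _ => 0 :=
  ⟨contDiff_const, fun x w => (leviForm_zero x w).ge, univ, isOpen_univ, subset_univ _,
    fun x _ w => leviForm_zero x w⟩

theorem IsPshPluriharmonicNear.add {K : Set (ℂ^n)} {u v : (ℂ^n) → ℝ}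
    (hu : IsPshPluriharmonicNear K u) (hv : IsPshPluriharmonicNear K v) :
    IsPshPluriharmonicNear K fun z => u z + v z := by
  obtain ⟨hu, hu0, N, hN, hKN, huN⟩ := hu
  obtain ⟨hv, hv0, N', hN', hKN', hvN'⟩ := hv
  refine ⟨hu.add hv, fun x w => ?_, N ∩ N', hN.inter hN', subset_inter hKN hKN',
    fun x hx w => ?_⟩
  · rw [leviForm_add hu hv]
    exact add_nonneg (hu0 x w) (hv0 x w)
  · rw [leviForm_add hu hv, huN x hx.1, hvN' x hx.2, add_zero]

theorem IsPshPluriharmonicNear.const_mul {K : Set (ℂ^n)} {u : (ℂ^n) → ℝ}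
    (hu : IsPshPluriharmonicNear K u) {c : ℝ} (hc : 0 ≤ c) :
    IsPshPluriharmonicNear K fun z => c * u z := by
  obtain ⟨hu, hu0, N, hN, hKN, huN⟩ := hu
  refine ⟨contDiff_const.mul hu, fun x w => ?_, N, hN, hKN, fun x hx w => ?_⟩
  · rw [leviForm_const_mul hu]
    exact mul_nonneg hc (hu0 x w)
  · rw [leviForm_const_mul hu, huN x hx, mul_zero]

theorem PrincipalConvex.exists_leviForm_pos {K : Set (ℂ^n)} (hK : PrincipalConvex K)
    (hKc : IsCompact K) {a w : ℂ^n} (ha : a ∉ K) (hw : w ≠ 0) :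
    ∃ u, IsPshPluriharmonicNear K u ∧ 0 < leviForm u a w := by
  obtain ⟨f, hf, hfa, hfK⟩ := hK a ha
  obtain ⟨G, hG, hG0, hG2, c, hc, hGc⟩ := exists_radial_subharmonic_profile
  obtain ⟨F, hF, hFa, hFw, hFK⟩ :=
    exists_differentiable_fderiv_apply_ne_zero hKc hf hfa hfK hw hc
  refine ⟨fun z => G (‖F z‖ ^ 2), ⟨hG.comp (contDiff_norm_sq_comp hF), fun x v => ?_,
    {z | 2 < ‖F z‖ ^ 2}, isOpen_lt continuous_const (hF.continuous.norm.pow 2), fun z hz => ?_,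
    fun x hx v => ?_⟩, ?_⟩
  · rw [leviForm_radial_comp hG hF]
    exact mul_nonneg (by positivity) (hG0 _)
  · have := hFK z hz
    change 2 < ‖F z‖ ^ 2
    nlinarith
  · rw [leviForm_radial_comp hG hF, hG2 _ hx, mul_zero]
  · rw [leviForm_radial_comp hG hF, hFa]
    have := norm_pos_iff.2 hFw
    positivity

theorem PrincipalConvex.exists_leviForm_pos_on {K : Set (ℂ^n)} (hK : PrincipalConvex K)
    (hKc : IsCompact K) {S : Set ((ℂ^n) × (ℂ^n))} (hS : IsCompact S)
    (hS' : ∀ p ∈ S, p.1 ∉ K ∧ p.2 ≠ 0) :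
    ∃ u, IsPshPluriharmonicNear K u ∧ ∀ p ∈ S, 0 < leviForm u p.1 p.2 := by
  refine hS.induction_on
    (p := fun S => ∃ u, IsPshPluriharmonicNear K u ∧ ∀ p ∈ S, 0 < leviForm u p.1 p.2)
    ⟨_, .zero K, by simp⟩ ?_ ?_ ?_
  · rintro s t hst ⟨u, hu, hut⟩
    exact ⟨u, hu, fun p hp => hut p (hst hp)⟩
  · rintro s t ⟨u, hu, hus⟩ ⟨v, hv, hvt⟩
    refine ⟨_, hu.add hv, fun p hp => ?_⟩
    rw [leviForm_add hu.1 hv.1]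
    rcases hp with hp | hp
    · exact add_pos_of_pos_of_nonneg (hus p hp) (hv.2.1 _ _)
    · exact add_pos_of_nonneg_of_pos (hu.2.1 _ _) (hvt p hp)
  · intro p hp
    obtain ⟨u, hu, hup⟩ := hK.exists_leviForm_pos hKc (hS' p hp).1 (hS' p hp).2
    refine ⟨{q | 0 < leviForm u q.1 q.2}, mem_nhdsWithin_of_mem_nhds ?_, u, hu, fun q hq => hq⟩
    exact (isOpen_lt continuous_const (continuous_leviForm hu.1)).mem_nhds hup

theorem PrincipalConvex.exists_leviForm_ge {K : Set (ℂ^n)} (hK : PrincipalConvex K)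
    (hKc : IsCompact K) {C : Set (ℂ^n)} (hC : IsCompact C) (hCK : Disjoint C K) :
    ∃ u, IsPshPluriharmonicNear K u ∧ ∀ x ∈ C, ∀ w, 4 * ‖w‖ ^ 2 ≤ leviForm u x w := by
  have hS : IsCompact (C ×ˢ sphere (0 : ℂ^n) 1) := hC.prod (isCompact_sphere 0 1)
  obtain ⟨u, hu, hpos⟩ := hK.exists_leviForm_pos_on hKc hS fun p hp =>
    ⟨disjoint_left.1 hCK hp.1, ne_of_mem_sphere hp.2 one_ne_zero⟩
  obtain ⟨B, hB⟩ := hS.exists_bound_of_continuousOn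
    ((continuous_leviForm hu.1).continuousOn.inv₀ fun p hp => (hpos p hp).ne')
  refine ⟨_, hu.const_mul (c := 4 * |B|) (by positivity), fun x hx w => ?_⟩
  rw [leviForm_const_mul hu.1]
  rcases eq_or_ne w 0 with rfl | hw
  · have := hu.2.1 x 0
    simpa using mul_nonneg (mul_nonneg zero_le_four (abs_nonneg B)) this
  have hw' : 0 < ‖w‖ := norm_pos_iff.2 hw
  have hmem : (x, ‖w‖⁻¹ • w) ∈ C ×ˢ sphere (0 : ℂ^n) 1 :=
    ⟨hx, by simp [norm_smul, hw'.ne']⟩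
  have h1 := hpos _ hmem
  have h2 := (le_abs_self _).trans ((hB _ hmem).trans (le_abs_self B))
  have h3 : 1 ≤ |B| * leviForm u x (‖w‖⁻¹ • w) := (inv_le_iff_one_le_mul₀ h1).1 h2
  rw [leviForm_smul_right, inv_pow] at h3
  have h4 : ‖w‖ ^ 2 ≤ |B| * leviForm u x w := by
    have h5 := mul_le_mul_of_nonneg_left h3 (sq_nonneg ‖w‖)
    have h6 : ‖w‖ ^ 2 * (|B| * ((‖w‖ ^ 2)⁻¹ * leviForm u x w)) = |B| * leviForm u x w := by
      field_simp
    linarith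
  linarith

end LeviForm

/-- if `K ⊂ ℂⁿ` is compact and convex with respect to principal hypersurfaces,
then for every `ε > 0` and bounded open `V ⊇ K` there is a smooth global `u` with
`H_u ≥ 4‖w‖²` outside `V`, `u` pluriharmonic near `K`, and `H_u ≥ -4ε‖w‖²` on `V`. -/
theorem stmt4 (n : ℕ) (hn : 1 ≤ n) (K : Set (EuclideanSpace ℂ (Fin n))) (hKc : IsCompact K)
    (hK : PrincipalConvex K) :
    ∀ ε : ℝ, 0 < ε →
      ∀ V : Set (EuclideanSpace ℂ (Fin n)), IsOpen V → Bornology.IsBounded V → K ⊆ V →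
        ∃ u : EuclideanSpace ℂ (Fin n) → ℝ, ContDiff ℝ (⊤ : ℕ∞) u ∧
          (∀ x ∉ V, ∀ w : EuclideanSpace ℂ (Fin n), 4 * ‖w‖ ^ 2 ≤ leviForm u x w) ∧
          (∃ N : Set (EuclideanSpace ℂ (Fin n)), IsOpen N ∧ K ⊆ N ∧
            ∀ x ∈ N, ∀ w : EuclideanSpace ℂ (Fin n), leviForm u x w = 0) ∧
          (∀ x ∈ V, ∀ w : EuclideanSpace ℂ (Fin n), -(4 * ε * ‖w‖ ^ 2) ≤ leviForm u x w) := by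
  intro ε hε V hV hVb hKV
  obtain ⟨R, hR⟩ := hVb.subset_ball 0
  obtain ⟨G, hG, hG1, hG2, hG0, hGR⟩ := exists_convex_cutoff (R ^ 2)
  have hC : IsCompact (closedBall (0 : EuclideanSpace ℂ (Fin n)) √(R ^ 2 + 1) \ V) :=
    (isCompact_closedBall _ _).diff hV
  obtain ⟨u, hu, huC⟩ := hK.exists_leviForm_ge hKc hC (disjoint_sdiff_left.mono_right hKV)
  have hns : ContDiff ℝ (⊤ : ℕ∞) fun z : EuclideanSpace ℂ (Fin n) => ‖z‖ ^ 2 :=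
    contDiff_norm_sq ℝ
  have hφ : ContDiff ℝ (⊤ : ℕ∞) fun z : EuclideanSpace ℂ (Fin n) => G (‖z‖ ^ 2) := hG.comp hns
  have hφ0 : ∀ x w : EuclideanSpace ℂ (Fin n),
      deriv G (‖x‖ ^ 2) * (4 * ‖w‖ ^ 2) ≤ leviForm (fun z => G (‖z‖ ^ 2)) x w := fun x w => by
    rw [leviForm_comp hG hns, leviForm_norm_sq]
    have := hG2 (‖x‖ ^ 2)
    exact le_add_of_nonneg_left (by positivity)
  have hφ1 : ∀ x w : EuclideanSpace ℂ (Fin n), 0 ≤ leviForm (fun z => G (‖z‖ ^ 2)) x w :=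
    fun x w => (mul_nonneg (hG1 _) (by positivity)).trans (hφ0 x w)
  have hadd := leviForm_add hu.1 hφ
  obtain ⟨hu1, hu0, N, hN, hKN, huN⟩ := hu
  refine ⟨fun z => u z + G (‖z‖ ^ 2), hu1.add hφ, fun x hx w => ?_,
    ⟨N ∩ V, hN.inter hV, subset_inter hKN hKV, fun x hx w => ?_⟩, fun x _ w => ?_⟩
  · rw [hadd]
    by_cases hxR : x ∈ closedBall (0 : EuclideanSpace ℂ (Fin n)) √(R ^ 2 + 1)
    · exact le_add_of_le_of_nonneg (huC x ⟨hxR, hx⟩ w) (hφ1 x w)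
    · have h1 : R ^ 2 + 1 ≤ ‖x‖ ^ 2 := by
        rw [mem_closedBall_zero_iff, not_le] at hxR
        exact ((Real.sqrt_lt' ((Real.sqrt_nonneg _).trans_lt hxR)).1 hxR).le
      have h2 := hφ0 x w
      rw [hGR _ h1, one_mul] at h2
      exact le_add_of_nonneg_of_le (hu0 x w) h2
  · have h1 : ‖x‖ ^ 2 < R ^ 2 :=
      pow_lt_pow_left₀ (mem_ball_zero_iff.1 (hR hx.2)) (norm_nonneg _) two_ne_zero
    rw [hadd, huN x hx.1, leviForm_comp hG hns, (hG0 _ h1).1, (hG0 _ h1).2]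
    simp
  · rw [hadd]
    have h1 : 0 ≤ 4 * ε * ‖w‖ ^ 2 := by positivity
    linarith [hu0 x w, hφ1 x w]
end

section
/- Let n ≥ 1 and let K ⊂ ℂⁿ be a compact set that is convex with respect to principal hypersurfaces. Suppose K is the union of two disjoint compact sets L and M. Then both L and M are convex with respect to principal hypersurfaces. -/
open Complex

open Filter Topology

theorem sum_antidiagonal_centralBinom (n : ℕ) :
    ∑ p ∈ Finset.HasAntidiagonal.antidiagonal n, p.1.centralBinom * p.2.centralBinom = 4 ^ n := by
  let s : PowerSeries ℚ := PowerSeries.mk fun k => (k.centralBinom : ℚ)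
  have h4 : (4 : PowerSeries ℚ) = PowerSeries.C (4 : ℚ) := (map_ofNat PowerSeries.C 4).symm
  have h2 : (2 : PowerSeries ℚ) = PowerSeries.C (2 : ℚ) := (map_ofNat PowerSeries.C 2).symm
  have hs : PowerSeries.derivative ℚ s * (1 - 4 * PowerSeries.X) = 2 * s := by
    ext k
    have key' : ((k : ℚ) + 1) * ((k + 1).centralBinom : ℚ) = 2 * (2 * k + 1) * k.centralBinom := by
      exact_mod_cast Nat.succ_mul_centralBinom_succ k
    rw [mul_sub, mul_one, map_sub, h4, h2, mul_left_comm, PowerSeries.coeff_C_mul,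
      PowerSeries.coeff_C_mul, PowerSeries.coeff_derivative]
    cases k with
    | zero => simp [s, Nat.centralBinom]
    | succ k =>
      rw [PowerSeries.coeff_succ_mul_X, PowerSeries.coeff_derivative]
      simp only [s, PowerSeries.coeff_mk]
      push_cast at key' ⊢
      linarith
  have hone : s * s * (1 - 4 * PowerSeries.X) = 1 := by
    apply PowerSeries.derivative.ext
    · have hd : PowerSeries.derivative ℚ (1 - 4 * PowerSeries.X) = -4 := by
        rw [h4, map_sub, Derivation.map_one_eq_zero, ← PowerSeries.smul_eq_C_mul,
          Derivation.map_smul, PowerSeries.derivative_X, PowerSeries.smul_eq_C_mul, mul_one,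
          zero_sub]
      rw [Derivation.leibniz, Derivation.leibniz, hd]
      simp only [smul_eq_mul]
      rw [Derivation.map_one_eq_zero]
      linear_combination 2 * s * hs
    · simp [s]
  have hg : (PowerSeries.mk fun k => (4 : ℚ) ^ k) * (1 - 4 * PowerSeries.X) = 1 := by
    ext k
    rw [mul_sub, mul_one, map_sub, h4, mul_left_comm, PowerSeries.coeff_C_mul]
    cases k with
    | zero => simp
    | succ k => simp [PowerSeries.coeff_one, pow_succ, mul_comm]
  have h : s * s = PowerSeries.mk fun k => (4 : ℚ) ^ k := by
    linear_combination (PowerSeries.mk fun k => (4 : ℚ) ^ k) * hone - s * s * hg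
  have := congrArg (PowerSeries.coeff n) h
  rw [PowerSeries.coeff_mul] at this
  simp only [s, PowerSeries.coeff_mk] at this
  exact_mod_cast this

/-- Polynomials in `x` which converge to an idempotent when `x - x ^ 2` is small. -/
noncomputable def idempotentApprox {R : Type*} [CommRing R] [Algebra ℂ R] (k : ℕ) (x : R) : R :=
  (1 / 2 : ℂ) •
    (1 + (2 * x - 1) * ∑ j ∈ Finset.range (k + 1), (j.centralBinom : R) * (x - x ^ 2) ^ j)

theorem map_idempotentApprox {R S : Type*} [CommRing R] [Algebra ℂ R] [CommRing S] [Algebra ℂ S]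
    (φ : R →ₐ[ℂ] S) (k : ℕ) (x : R) :
    φ (idempotentApprox k x) = idempotentApprox k (φ x) := by
  simp only [idempotentApprox, map_smul, map_add, map_mul, map_sub, map_sum, map_pow, map_natCast,
    map_one, map_ofNat]

theorem idempotentApprox_one_sub {R : Type*} [CommRing R] [Algebra ℂ R] (k : ℕ) (x : R) :
    idempotentApprox k (1 - x) = 1 - idempotentApprox k x := by
  have h : (1 - x) - (1 - x) ^ 2 = x - x ^ 2 := by ring
  have h2 : (1 / 2 : ℂ) • (2 : R) = 1 := by
    rw [← one_add_one_eq_two (R := R), smul_add, ← add_smul, add_halves, one_smul]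
  unfold idempotentApprox
  rw [h, eq_sub_iff_add_eq, ← smul_add]
  refine Eq.trans ?_ h2
  congr 1
  ring

theorem geom_sum_le_two {t : ℝ} (h0 : 0 ≤ t) (h1 : t ≤ 1 / 2) (k : ℕ) :
    ∑ j ∈ Finset.range k, t ^ j ≤ 2 := by
  induction k with
  | zero => simp
  | succ k ih =>
    rw [geom_sum_succ]
    nlinarith

theorem norm_idempotentApprox_le {x : ℂ} {δ : ℝ} (hδ : δ ≤ 1 / 32) (hx : ‖x‖ ≤ δ) (k : ℕ) :
    ‖idempotentApprox k x‖ ≤ 16 * δ := by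
  have hx0 := norm_nonneg x
  set u := x - x ^ 2 with hu
  have hun : ‖u‖ ≤ 2 * δ := by
    calc ‖u‖ ≤ ‖x‖ + ‖x ^ 2‖ := norm_sub_le _ _
      _ ≤ 2 * δ := by rw [norm_pow]; nlinarith
  set T := ∑ j ∈ Finset.range k, ((j + 1).centralBinom : ℂ) * u ^ (j + 1) with hT
  have hTn : ‖T‖ ≤ 16 * δ := by
    calc ‖T‖ ≤ ∑ j ∈ Finset.range k, (4 * ‖u‖) ^ j * (4 * ‖u‖) := by
          refine norm_sum_le_of_le _ fun j _ => ?_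
          rw [norm_mul, norm_pow, Complex.norm_natCast, ← pow_succ, mul_pow]
          gcongr
          exact_mod_cast Nat.centralBinom_le_four_pow (j + 1)
      _ = (∑ j ∈ Finset.range k, (4 * ‖u‖) ^ j) * (4 * ‖u‖) := by rw [Finset.sum_mul]
      _ ≤ 2 * (4 * ‖u‖) := by
          gcongr
          exact geom_sum_le_two (by positivity) (by linarith) k
      _ ≤ 16 * δ := by linarith
  have key : idempotentApprox k x = (1 / 2) * (2 * x * (1 + T) - T) := by
    rw [idempotentApprox, Finset.sum_range_succ', smul_eq_mul, ← hu, ← hT]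
    simp only [Nat.centralBinom_zero, Nat.cast_one, pow_zero, mul_one]
    ring
  rw [key, norm_mul]
  have h1 : ‖2 * x * (1 + T) - T‖ ≤ 2 * δ * (1 + 16 * δ) + 16 * δ := by
    calc ‖2 * x * (1 + T) - T‖ ≤ ‖2 * x‖ * ‖1 + T‖ + ‖T‖ := by
          rw [← norm_mul]; exact norm_sub_le _ _
      _ ≤ 2 * δ * (1 + 16 * δ) + 16 * δ := by
          have hδ0 : 0 ≤ δ := hx0.trans hx
          gcongr
          · rw [norm_mul, Complex.norm_ofNat]; linarith
          · exact (norm_add_le _ _).trans (by rw [norm_one]; linarith)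
  have h2 : ‖(1 / 2 : ℂ)‖ = 1 / 2 := by norm_num
  rw [h2]
  nlinarith

theorem norm_idempotentApprox_sub_one_le {x : ℂ} {δ : ℝ} (hδ : δ ≤ 1 / 32) (hx : ‖x - 1‖ ≤ δ)
    (k : ℕ) : ‖idempotentApprox k x - 1‖ ≤ 16 * δ := by
  have h := norm_idempotentApprox_le (x := 1 - x) hδ (by rwa [norm_sub_rev]) k
  rwa [idempotentApprox_one_sub, norm_sub_rev] at h

theorem exists_tendsto_idempotentApprox {B : Type*} [NormedCommRing B] [NormedAlgebra ℂ B]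
    [CompleteSpace B] (x : B)
    (hx : ∀ φ : WeakDual.characterSpace ℂ B, ‖φ x‖ ≤ 1 / 32 ∨ ‖φ x - 1‖ ≤ 1 / 32) :
    ∃ e : B, e ^ 2 = e ∧ Tendsto (fun k => idempotentApprox k x) atTop (𝓝 e) := by
  set u := x - x ^ 2 with hu
  have hspec : spectralRadius ℂ u < (1 / 8 : NNReal) := by
    have : spectralRadius ℂ u ≤ (1 / 10 : NNReal) := by
      refine iSup₂_le fun z hz => ?_
      obtain ⟨φ, rfl⟩ := WeakDual.CharacterSpace.mem_spectrum_iff_exists.1 hz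
      rw [ENNReal.coe_le_coe, ← NNReal.coe_le_coe]
      have h1 : φ u = φ x * (1 - φ x) := by rw [hu, map_sub, map_pow]; ring
      rw [h1, coe_nnnorm, norm_mul]
      push_cast
      have ha := norm_nonneg (φ x)
      have hb := norm_nonneg (1 - φ x)
      rcases hx φ with h | h
      · have : ‖1 - φ x‖ ≤ 1 + ‖φ x‖ := (norm_sub_le _ _).trans (by rw [norm_one])
        nlinarith
      · have : ‖φ x‖ ≤ ‖φ x - 1‖ + 1 := by
          simpa using norm_add_le (φ x - 1) 1
        rw [norm_sub_rev] at h this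
        nlinarith
    refine this.trans_lt ?_
    rw [ENNReal.coe_lt_coe, ← NNReal.coe_lt_coe]
    norm_num
  have hpow : ∀ᶠ n : ℕ in atTop, ‖u ^ n‖ ≤ (1 / 8 : ℝ) ^ n := by
    have h := (spectrum.pow_nnnorm_pow_one_div_tendsto_nhds_spectralRadius u).eventually_lt_const
      hspec
    filter_upwards [h, eventually_gt_atTop 0] with n hn hn0
    have h1 := ENNReal.rpow_le_rpow hn.le (Nat.cast_nonneg (α := ℝ) n)
    rw [← ENNReal.rpow_mul, one_div_mul_cancel (by positivity), ENNReal.rpow_one,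
      ENNReal.rpow_natCast, ← ENNReal.coe_pow, ENNReal.coe_le_coe, ← NNReal.coe_le_coe] at h1
    simpa using h1
  have hsum : Summable fun n : ℕ => ‖(n.centralBinom : B) * u ^ n‖ := by
    refine summable_of_isBigO_nat (g := fun n : ℕ => (1 / 2 : ℝ) ^ n)
      (summable_geometric_of_lt_one (by norm_num) (by norm_num)) ?_
    refine Asymptotics.IsBigO.of_bound 1 ?_
    filter_upwards [hpow] with n hn
    rw [← nsmul_eq_mul, norm_norm, one_mul, Real.norm_of_nonneg (by positivity)]
    calc ‖n.centralBinom • u ^ n‖ ≤ n.centralBinom * ‖u ^ n‖ := norm_nsmul_le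
      _ ≤ 4 ^ n * (1 / 8) ^ n := by
          gcongr
          exact_mod_cast Nat.centralBinom_le_four_pow n
      _ = (1 / 2) ^ n := by rw [← mul_pow]; norm_num
  set s := ∑' n : ℕ, (n.centralBinom : B) * u ^ n with hs
  have hgeo : s * s = ∑' n : ℕ, (4 * u) ^ n := by
    rw [hs, tsum_mul_tsum_eq_tsum_sum_antidiagonal_of_summable_norm hsum hsum]
    refine tsum_congr fun n => ?_
    rw [mul_pow, show (4 : B) ^ n = ((4 ^ n : ℕ) : B) by push_cast; rfl,
      ← sum_antidiagonal_centralBinom, Nat.cast_sum, Finset.sum_mul]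
    refine Finset.sum_congr rfl fun p hp => ?_
    rw [← Finset.HasAntidiagonal.mem_antidiagonal.1 hp, pow_add]
    push_cast
    ring
  have hgsum : Summable fun n : ℕ => (4 * u) ^ n := by
    refine Summable.of_norm_bounded_eventually_nat (g := fun n : ℕ => (1 / 2 : ℝ) ^ n)
      (summable_geometric_of_lt_one (by norm_num) (by norm_num)) ?_
    filter_upwards [hpow] with n hn
    rw [mul_pow, show (4 : B) ^ n = ((4 ^ n : ℕ) : B) by push_cast; rfl, ← nsmul_eq_mul]
    calc ‖(4 ^ n) • u ^ n‖ ≤ (4 ^ n : ℕ) * ‖u ^ n‖ := norm_nsmul_le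
      _ ≤ 4 ^ n * (1 / 8) ^ n := by push_cast; gcongr
      _ = (1 / 2) ^ n := by rw [← mul_pow]; norm_num
  have hss : s * s * (1 - 4 * u) = 1 := by
    rw [hgeo]; exact hgsum.tsum_pow_mul_one_sub
  refine ⟨(1 / 2 : ℂ) • (1 + (2 * x - 1) * s), ?_, ?_⟩
  · have hw : ((2 * x - 1) * s) ^ 2 = 1 := by
      calc _ = s * s * (1 - 4 * u) := by rw [hu]; ring
        _ = 1 := hss
    have h2 : (1 / 2 : ℂ) • (2 : B) = 1 := by
      rw [← one_add_one_eq_two (R := B), smul_add, ← add_smul, add_halves, one_smul]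
    rw [smul_pow, add_sq, hw, pow_two (1 / 2 : ℂ), mul_smul]
    congr 1
    calc _ = (1 / 2 : ℂ) • (2 : B) * (1 + (2 * x - 1) * s) := by
          rw [smul_mul_assoc]; congr 1; ring
      _ = _ := by rw [h2, one_mul]
  · have h := (hsum.of_norm.hasSum.tendsto_sum_nat).comp (tendsto_add_atTop_nat 1)
    exact ((h.const_mul _).const_add _).const_smul _

theorem tendsto_idempotentApprox_sub {B : Type*} [NormedCommRing B] [NormedAlgebra ℂ B]
    [CompleteSpace B] (x y : B)
    (h : ∀ φ : WeakDual.characterSpace ℂ B, (‖φ x‖ ≤ 1 / 64 ∧ ‖φ y‖ ≤ 1 / 64) ∨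
      (‖φ x - 1‖ ≤ 1 / 64 ∧ ‖φ y - 1‖ ≤ 1 / 64)) :
    Tendsto (fun k => idempotentApprox k x - idempotentApprox k y) atTop (𝓝 0) := by
  obtain ⟨e, he, hex⟩ := exists_tendsto_idempotentApprox x fun φ =>
    (h φ).imp (fun h => h.1.trans (by norm_num)) (fun h => h.1.trans (by norm_num))
  obtain ⟨f, hf, hfy⟩ := exists_tendsto_idempotentApprox y fun φ =>
    (h φ).imp (fun h => h.2.trans (by norm_num)) (fun h => h.2.trans (by norm_num))
  suffices hef : e - f = 0 by rw [← hef]; exact hex.sub hfy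
  have hchar : ∀ φ : WeakDual.characterSpace ℂ B, φ (e - f) = 0 := by
    intro φ
    have hlim : ∀ {x e : B}, Tendsto (fun k => idempotentApprox k x) atTop (𝓝 e) →
        Tendsto (fun k => idempotentApprox k (φ x)) atTop (𝓝 (φ e)) := by
      intro x e hx
      have := ((map_continuous φ).tendsto e).comp hx
      refine this.congr fun k => ?_
      exact map_idempotentApprox (WeakDual.CharacterSpace.toAlgHom φ) k x
    have hzero : ∀ {x e : B}, e ^ 2 = e → Tendsto (fun k => idempotentApprox k x) atTop (𝓝 e) →
        ‖φ x‖ ≤ 1 / 64 → φ e = 0 := by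
      intro x e he hx hφ
      have h1 : ‖φ e‖ ≤ 16 * (1 / 64) := le_of_tendsto' (hlim hx).norm fun k =>
        norm_idempotentApprox_le (by norm_num) hφ k
      have h2 : φ e * (φ e - 1) = 0 := by
        have := congrArg φ he
        rw [map_pow] at this
        linear_combination this
      rcases mul_eq_zero.1 h2 with h3 | h3
      · exact h3
      · rw [sub_eq_zero.1 h3, norm_one] at h1
        norm_num at h1
    have hone : ∀ {x e : B}, e ^ 2 = e → Tendsto (fun k => idempotentApprox k x) atTop (𝓝 e) →
        ‖φ x - 1‖ ≤ 1 / 64 → φ e = 1 := by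
      intro x e he hx hφ
      have h1 : φ (1 - e) = 0 := by
        refine hzero (x := 1 - x) (by linear_combination he) ?_ ?_
        · simp only [idempotentApprox_one_sub]
          exact hx.const_sub 1
        · rwa [map_sub, map_one, norm_sub_rev]
      rw [map_sub, map_one, sub_eq_zero] at h1
      exact h1.symm
    rw [map_sub]
    rcases h φ with h | h
    · rw [hzero he hex h.1, hzero hf hfy h.2, sub_zero]
    · rw [hone he hex h.1, hone hf hfy h.2, sub_self]
  have hunit : IsUnit (1 - (e - f) ^ 2) := by
    by_contra hn
    obtain ⟨φ, hφ⟩ := WeakDual.CharacterSpace.exists_apply_eq_zero hn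
    rw [map_sub, map_pow, hchar, map_one] at hφ
    norm_num at hφ
  rw [← hunit.mul_left_eq_zero]
  linear_combination (-e - 1 + 3 * f) * he + (f + 1 - 3 * e) * hf

theorem tendsto_norm_idempotentApprox_sub {S : Type*} [SeminormedCommRing S] [NormedAlgebra ℂ S]
    (h1 : ‖(1 : S)‖ ≤ 1) (x y : S)
    (h : ∀ φ : S →ₐ[ℂ] ℂ, (∀ s, ‖φ s‖ ≤ ‖s‖) → (‖φ x‖ ≤ 1 / 64 ∧ ‖φ y‖ ≤ 1 / 64) ∨
      (‖φ x - 1‖ ≤ 1 / 64 ∧ ‖φ y - 1‖ ≤ 1 / 64)) :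
    Tendsto (fun k => ‖idempotentApprox k x - idempotentApprox k y‖) atTop (𝓝 0) := by
  let j : S →ₐ[ℂ] UniformSpace.Completion S :=
    { UniformSpace.Completion.coeRingHom with
      commutes' := fun c => by
        rw [Algebra.algebraMap_eq_smul_one, Algebra.algebraMap_eq_smul_one]
        exact (UniformSpace.Completion.coe_smul c (1 : S)).trans (by rfl) }
  have hj : ∀ s, ‖j s‖ = ‖s‖ := fun s => UniformSpace.Completion.norm_coe s
  have := tendsto_idempotentApprox_sub (j x) (j y) fun φ => by
    refine h ((WeakDual.CharacterSpace.toAlgHom φ).comp j) fun s => ?_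
    have hs := spectrum.norm_le_norm_mul_of_mem
      (AlgHom.apply_mem_spectrum (WeakDual.CharacterSpace.toAlgHom φ) (j s))
    refine hs.trans ?_
    rw [← map_one j, hj, hj]
    exact mul_le_of_le_one_right (norm_nonneg _) h1
  refine this.norm.congr' (.of_forall fun k => ?_) |>.trans (by rw [norm_zero])
  rw [← map_idempotentApprox, ← map_idempotentApprox, ← map_sub, hj]

/-- `LaurentBound A Y g f C`: on the points of `Y` where `g` does not vanish, `f` is a Laurent
polynomial in `g` with coefficients in `A`, and the sum of the norms of its terms is at most `C`,
where coefficients are measured by their supremum over `Y`, positive powers of `g` count as powers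
of `2`, and negative ones as `1`. -/
inductive LaurentBound {X : Type*} (A : Subalgebra ℂ (X → ℂ)) (Y : Set X) (g : X → ℂ) :
    (X → ℂ) → ℝ → Prop
  | term (a : X → ℂ) (k : ℤ) (C : ℝ) (ha : a ∈ A) (hC : 0 ≤ C) (haC : ∀ y ∈ Y, ‖a y‖ ≤ C) :
      LaurentBound A Y g (fun x => a x * g x ^ k) (C * 2 ^ k.toNat)
  | add {f f' : X → ℂ} {C C' : ℝ} (h : LaurentBound A Y g f C) (h' : LaurentBound A Y g f' C') :
      LaurentBound A Y g (f + f') (C + C')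
  | congr {f f' : X → ℂ} {C C' : ℝ} (h : LaurentBound A Y g f C)
      (hf : ∀ y ∈ Y, g y ≠ 0 → f y = f' y) (hC : C ≤ C') : LaurentBound A Y g f' C'

namespace LaurentBound

variable {X : Type*} {A : Subalgebra ℂ (X → ℂ)} {Y : Set X} {g f f' : X → ℂ} {C C' : ℝ}

theorem nonneg (h : LaurentBound A Y g f C) : 0 ≤ C := by
  induction h with
  | term a k C ha hC haC => positivity
  | add _ _ h h' => exact add_nonneg h h'
  | congr _ _ hC h => exact h.trans hC

theorem of_mem {a : X → ℂ} (ha : a ∈ A) (hC : 0 ≤ C) (haC : ∀ y ∈ Y, ‖a y‖ ≤ C) :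
    LaurentBound A Y g a C :=
  (term a 0 C ha hC haC).congr (fun y _ _ => by simp) (by simp)

theorem const_mul (c : ℂ) (h : LaurentBound A Y g f C) :
    LaurentBound A Y g (c • f) (‖c‖ * C) := by
  induction h with
  | term a k C ha hC haC =>
    refine (term (c • a) k (‖c‖ * C) (A.smul_mem ha c) (by positivity) fun y hy => ?_).congr
      (fun y _ _ => ?_) (by rw [mul_assoc])
    · rw [Pi.smul_apply, norm_smul]
      gcongr
      exact haC y hy
    · simp [mul_assoc]
  | add _ _ h h' => rw [smul_add, mul_add]; exact h.add h'
  | congr _ hf hC h =>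
    exact h.congr (fun y hy hg => by simp [hf y hy hg]) (by gcongr)

theorem mul (h : LaurentBound A Y g f C) (h' : LaurentBound A Y g f' C') :
    LaurentBound A Y g (f * f') (C * C') := by
  induction h with
  | term a k C ha hC haC =>
    induction h' with
    | term b l D hb hD hbD =>
      refine (term (a * b) (k + l) (C * D) (A.mul_mem ha hb) (by positivity) fun y hy => ?_).congr
        (fun y _ hg => ?_) ?_
      · rw [Pi.mul_apply, norm_mul]
        exact mul_le_mul (haC y hy) (hbD y hy) (norm_nonneg _) hC
      · simp only [Pi.mul_apply]
        rw [zpow_add₀ hg]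
        ring
      · rw [mul_mul_mul_comm, ← pow_add]
        gcongr
        · norm_num
        · lia
    | add _ _ h h' => rw [mul_add, mul_add]; exact h.add h'
    | congr _ hf hC' h =>
      exact h.congr (fun y hy hg => by simp [hf y hy hg]) (by gcongr)
  | add _ _ h h' => rw [add_mul, add_mul]; exact h.add h'
  | congr _ hf hC h =>
    exact h.congr (fun y hy hg => by simp [hf y hy hg])
      (mul_le_mul_of_nonneg_right hC h'.nonneg)

theorem exists_split (hg : g ∈ A) (h : LaurentBound A Y g f C) :
    ∃ u ∈ A, ∃ v : X → ℂ, (∀ y ∈ Y, g y ≠ 0 → f y = u y + v y) ∧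
      (∀ y ∈ Y, ‖g y‖ ≤ 2 → ‖u y‖ ≤ C) ∧ (∀ y ∈ Y, 1 ≤ ‖g y‖ → ‖v y‖ ≤ C) := by
  induction h with
  | term a k C ha hC haC =>
    rcases le_or_gt 0 k with hk | hk
    · lift k to ℕ using hk
      refine ⟨a * g ^ k, A.mul_mem ha (A.pow_mem hg k), 0, fun y _ _ => by simp, fun y hy hgy => ?_,
        fun y _ _ => by simpa using by positivity⟩
      rw [Pi.mul_apply, Pi.pow_apply, norm_mul, norm_pow, Int.toNat_natCast]
      gcongr
      exact haC y hy
    · refine ⟨0, A.zero_mem, fun x => a x * g x ^ k, fun y _ _ => by simp,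
        fun y _ _ => by simpa using by positivity, fun y hy hgy => ?_⟩
      rw [Int.toNat_of_nonpos hk.le, pow_zero, norm_mul, norm_zpow]
      exact mul_le_mul (haC y hy) (zpow_le_one_of_nonpos₀ hgy hk.le) (by positivity) hC
  | add _ _ h h' =>
    obtain ⟨u, hu, v, hf, hin, hout⟩ := h
    obtain ⟨u', hu', v', hf', hin', hout'⟩ := h'
    refine ⟨u + u', A.add_mem hu hu', v + v', fun y hy hgy => ?_, fun y hy hgy => ?_,
      fun y hy hgy => ?_⟩
    · simp only [Pi.add_apply, hf y hy hgy, hf' y hy hgy]; ring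
    · exact norm_add_le_of_le (hin y hy hgy) (hin' y hy hgy)
    · exact norm_add_le_of_le (hout y hy hgy) (hout' y hy hgy)
  | congr _ hf hC h =>
    obtain ⟨u, hu, v, hf', hin, hout⟩ := h
    exact ⟨u, hu, v, fun y hy hgy => (hf y hy hgy).symm.trans (hf' y hy hgy),
      fun y hy hgy => (hin y hy hgy).trans hC, fun y hy hgy => (hout y hy hgy).trans hC⟩

end LaurentBound

/-- The functions which admit a `LaurentBound`. -/
def laurentAlgebra {X : Type*} (A : Subalgebra ℂ (X → ℂ)) (Y : Set X) (g : X → ℂ) :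
    Subalgebra ℂ (X → ℂ) where
  carrier := {f | ∃ C, LaurentBound A Y g f C}
  mul_mem' := fun ⟨C, h⟩ ⟨C', h'⟩ => ⟨C * C', h.mul h'⟩
  add_mem' := fun ⟨C, h⟩ ⟨C', h'⟩ => ⟨C + C', h.add h'⟩
  algebraMap_mem' c := ⟨‖c‖, .of_mem (A.algebraMap_mem c) (norm_nonneg c) fun _ _ => le_of_eq rfl⟩

theorem LaurentBound.bddBelow {X : Type*} (A : Subalgebra ℂ (X → ℂ)) (Y : Set X) (g f : X → ℂ) :
    BddBelow {C | LaurentBound A Y g f C} :=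
  ⟨0, fun _ h => h.nonneg⟩

/-- The infimum of the bounds of a function in `laurentAlgebra`. -/
noncomputable def laurentSeminorm {X : Type*} (A : Subalgebra ℂ (X → ℂ)) (Y : Set X) (g : X → ℂ) :
    RingSeminorm (laurentAlgebra A Y g) where
  toFun f := sInf {C | LaurentBound A Y g f C}
  map_zero' := le_antisymm
    (csInf_le (LaurentBound.bddBelow A Y g _)
      (LaurentBound.of_mem A.zero_mem le_rfl fun y _ => by simp))
    (Real.sInf_nonneg fun _ h => h.nonneg)
  add_le' f f' := by
    refine le_of_forall_pos_le_add fun ε hε => ?_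
    obtain ⟨C, hC, hCε⟩ := exists_lt_of_csInf_lt f.2 (lt_add_of_pos_right _ (half_pos hε))
    obtain ⟨C', hC', hCε'⟩ := exists_lt_of_csInf_lt f'.2 (lt_add_of_pos_right _ (half_pos hε))
    have := csInf_le (LaurentBound.bddBelow A Y g _) (LaurentBound.add hC hC')
    exact this.trans ((add_lt_add hCε hCε').le.trans_eq (by rw [add_add_add_comm, add_halves]; rfl))
  neg' f := by
    congr 1
    ext C
    refine ⟨fun h => ?_, fun h => ?_⟩
    · simpa using h.const_mul (-1)
    · simpa using h.const_mul (-1)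
  mul_le' f f' := by
    refine le_mul_of_forall_lt₀ fun C hC C' hC' => ?_
    obtain ⟨D, hD, hDC⟩ := exists_lt_of_csInf_lt f.2 hC
    obtain ⟨D', hD', hDC'⟩ := exists_lt_of_csInf_lt f'.2 hC'
    refine (csInf_le (LaurentBound.bddBelow A Y g _) (LaurentBound.mul hD hD')).trans ?_
    exact mul_le_mul hDC.le hDC'.le hD'.nonneg (hD.nonneg.trans hDC.le)

section

variable {X : Type*} {A : Subalgebra ℂ (X → ℂ)} {Y : Set X} {g : X → ℂ}

theorem laurentSeminorm_le {f : laurentAlgebra A Y g} {C : ℝ} (h : LaurentBound A Y g f C) :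
    laurentSeminorm A Y g f ≤ C :=
  csInf_le (LaurentBound.bddBelow A Y g _) h

theorem exists_laurentBound_of_lt {f : laurentAlgebra A Y g} {C : ℝ}
    (h : laurentSeminorm A Y g f < C) : LaurentBound A Y g f C := by
  obtain ⟨D, hD, hDC⟩ := exists_lt_of_csInf_lt f.2 h
  exact hD.congr (fun _ _ _ => rfl) hDC.le

theorem laurentSeminorm_smul_le (c : ℂ) (f : laurentAlgebra A Y g) :
    laurentSeminorm A Y g (c • f) ≤ ‖c‖ * laurentSeminorm A Y g f := by
  refine le_mul_of_forall_lt₀ fun C hC C' hC' => ?_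
  refine (laurentSeminorm_le ((exists_laurentBound_of_lt hC').const_mul c)).trans ?_
  have := (exists_laurentBound_of_lt hC').nonneg
  gcongr

end

theorem RingSeminorm.tendsto_idempotentApprox_sub {S : Type*} [CommRing S] [Algebra ℂ S]
    (p : RingSeminorm S) (hsmul : ∀ (c : ℂ) s, p (c • s) ≤ ‖c‖ * p s) (h1 : p 1 ≤ 1) (x y : S)
    (h : ∀ φ : S →ₐ[ℂ] ℂ, (∀ s, ‖φ s‖ ≤ p s) → (‖φ x‖ ≤ 1 / 64 ∧ ‖φ y‖ ≤ 1 / 64) ∨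
      (‖φ x - 1‖ ≤ 1 / 64 ∧ ‖φ y - 1‖ ≤ 1 / 64)) :
    Tendsto (fun k => p (idempotentApprox k x - idempotentApprox k y)) atTop (𝓝 0) := by
  let _ : SeminormedCommRing S := { p.toSeminormedRing, ‹CommRing S› with }
  let _ : NormedAlgebra ℂ S := { ‹Algebra ℂ S› with norm_smul_le := hsmul }
  exact tendsto_norm_idempotentApprox_sub h1 x y h

/-- Every character of `A` bounded by the supremum over `Y` is the evaluation at a point of `Y`. -/
structure CharactersInSet {X : Type*} (A : Subalgebra ℂ (X → ℂ)) (Y : Set X) : Prop where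
  bounded : ∀ a ∈ A, ∃ C, ∀ y ∈ Y, ‖a y‖ ≤ C
  exists_point : ∀ φ : A →ₐ[ℂ] ℂ,
    (∀ (a : A) (C : ℝ), 0 ≤ C → (∀ y ∈ Y, ‖(a : X → ℂ) y‖ ≤ C) → ‖φ a‖ ≤ C) →
      ∃ y ∈ Y, ∀ a : A, φ a = (a : X → ℂ) y

/-- Functions of the form `a / g ^ m` with `a ∈ A`, at the points where `g` does not vanish. -/
def adjoinInv {X : Type*} (A : Subalgebra ℂ (X → ℂ)) (g : X → ℂ) (hg : g ∈ A) :
    Subalgebra ℂ (X → ℂ) where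
  carrier := {f | ∃ a ∈ A, ∃ m : ℕ, ∀ x, g x ≠ 0 → f x * g x ^ m = a x}
  mul_mem' := by
    rintro f f' ⟨a, ha, m, h⟩ ⟨a', ha', m', h'⟩
    refine ⟨a * a', A.mul_mem ha ha', m + m', fun x hx => ?_⟩
    rw [Pi.mul_apply, Pi.mul_apply, ← h x hx, ← h' x hx]
    ring
  add_mem' := by
    rintro f f' ⟨a, ha, m, h⟩ ⟨a', ha', m', h'⟩
    refine ⟨a * g ^ m' + a' * g ^ m, A.add_mem (A.mul_mem ha (A.pow_mem hg _))
      (A.mul_mem ha' (A.pow_mem hg _)), m + m', fun x hx => ?_⟩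
    simp only [Pi.add_apply, Pi.mul_apply, Pi.pow_apply, ← h x hx, ← h' x hx]
    ring
  algebraMap_mem' c := ⟨_, A.algebraMap_mem c, 0, fun x _ => by simp⟩

section

variable {X : Type*} {A : Subalgebra ℂ (X → ℂ)} {Y L : Set X} {g : X → ℂ}

theorem le_adjoinInv (hg : g ∈ A) : A ≤ adjoinInv A g hg :=
  fun a ha => ⟨a, ha, 0, fun x _ => by simp⟩

theorem inv_mem_adjoinInv (hg : g ∈ A) : g⁻¹ ∈ adjoinInv A g hg :=
  ⟨1, A.one_mem, 1, fun x hx => by simp [hx]⟩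

theorem adjoinInv_le_laurentAlgebra (hA : CharactersInSet A Y) (hg : g ∈ A) :
    adjoinInv A g hg ≤ laurentAlgebra A Y g := by
  rintro f ⟨a, ha, m, h⟩
  obtain ⟨C, hC⟩ := hA.bounded a ha
  refine ⟨_, (LaurentBound.term a (-m) (max C 0) ha (le_max_right _ _) fun y hy =>
    (hC y hy).trans (le_max_left _ _)).congr (fun y _ hy => ?_) le_rfl⟩
  rw [← h y hy, mul_assoc, ← zpow_natCast, ← zpow_add₀ hy]
  simp

theorem CharactersInSet.sublevel (hA : CharactersInSet A Y) (hg : g ∈ A) :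
    CharactersInSet A {y ∈ Y | ‖g y‖ ≤ 2} where
  bounded a ha := (hA.bounded a ha).imp fun C hC y hy => hC y hy.1
  exists_point φ hφ := by
    obtain ⟨y, hy, h⟩ := hA.exists_point φ fun a C hC haC => hφ a C hC fun y hy => haC y hy.1
    refine ⟨y, ⟨hy, ?_⟩, h⟩
    have := hφ ⟨g, hg⟩ 2 zero_le_two fun y hy => hy.2
    rwa [h] at this

theorem CharactersInSet.exists_point_adjoinInv (hA : CharactersInSet A Y) (hg : g ∈ A)
    (φ : adjoinInv A g hg →ₐ[ℂ] ℂ)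
    (hφ : ∀ (a : X → ℂ) (ha : a ∈ A) (C : ℝ), 0 ≤ C → (∀ y ∈ Y, ‖a y‖ ≤ C) →
      ‖φ ⟨a, le_adjoinInv hg ha⟩‖ ≤ C)
    (hφeq : ∀ a b : adjoinInv A g hg, (∀ y ∈ Y, g y ≠ 0 → (a : X → ℂ) y = (b : X → ℂ) y) →
      φ a = φ b)
    (hle : ‖φ ⟨g⁻¹, inv_mem_adjoinInv hg⟩‖ ≤ 1) :
    ∃ y ∈ Y, 1 ≤ ‖g y‖ ∧ ∀ a, φ a = (a : X → ℂ) y := by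
  obtain ⟨y, hy, h⟩ := hA.exists_point (φ.comp (Subalgebra.inclusion (le_adjoinInv hg)))
    fun a C hC haC => hφ _ a.2 C hC haC
  have h (a : X → ℂ) (ha : a ∈ A) : φ ⟨a, le_adjoinInv hg ha⟩ = a y := h ⟨a, ha⟩
  have hinv : φ ⟨g⁻¹, inv_mem_adjoinInv hg⟩ * g y = 1 := by
    rw [← h g hg, ← map_mul, ← map_one φ]
    exact hφeq _ _ fun y _ hy0 => inv_mul_cancel₀ hy0
  have hgy1 : 1 ≤ ‖g y‖ := by
    have := congrArg norm hinv
    rw [norm_mul, norm_one] at this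
    rw [← this]
    exact mul_le_of_le_one_left (norm_nonneg _) hle
  have hg0 : g y ≠ 0 := norm_pos_iff.1 (zero_lt_one.trans_le hgy1)
  refine ⟨y, hy, hgy1, fun f => ?_⟩
  obtain ⟨a, ha, m, hf⟩ := f.2
  have h1 : φ f * g y ^ m = a y := by
    rw [← h g hg, ← map_pow, ← map_mul, ← h a ha]
    exact hφeq _ _ fun y _ hy0 => hf y hy0
  rw [← hf y hg0] at h1
  exact mul_right_cancel₀ (pow_ne_zero m hg0) h1

theorem CharactersInSet.superlevel (hA : CharactersInSet A Y) (hg : g ∈ A) :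
    CharactersInSet (adjoinInv A g hg) {y ∈ Y | 1 ≤ ‖g y‖} where
  bounded := by
    rintro f ⟨a, ha, m, h⟩
    obtain ⟨C, hC⟩ := hA.bounded a ha
    refine ⟨C, fun y hy => ?_⟩
    have hg0 : g y ≠ 0 := norm_pos_iff.1 (zero_lt_one.trans_le hy.2)
    refine le_trans ?_ (hC y hy.1)
    rw [← h y hg0, norm_mul, norm_pow]
    exact le_mul_of_one_le_right (norm_nonneg _) (one_le_pow₀ hy.2)
  exists_point φ hφ := by
    obtain ⟨y, hy, hgy, h⟩ := hA.exists_point_adjoinInv hg φ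
      (fun a ha C hC haC => hφ _ C hC fun y hy => haC y hy.1)
      (fun a b hab => by
        have := hφ (a - b) 0 le_rfl fun y hy => by
          have hg0 : g y ≠ 0 := norm_pos_iff.1 (zero_lt_one.trans_le hy.2)
          simp [hab y hy.1 hg0]
        rwa [norm_le_zero_iff, map_sub, sub_eq_zero] at this)
      (hφ _ 1 zero_le_one fun y hy => by simpa using inv_le_one_of_one_le₀ hy.2)
    exact ⟨y, ⟨hy, hgy⟩, h⟩

/-- `f` is uniformly within `ε` on `Y` of the indicator function of `L`. -/
def NearIndicator (f : X → ℂ) (Y L : Set X) (ε : ℝ) : Prop :=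
  ∀ y ∈ Y, (y ∈ L → ‖f y - 1‖ ≤ ε) ∧ (y ∉ L → ‖f y‖ ≤ ε)

theorem NearIndicator.idempotentApprox {f : X → ℂ} {δ : ℝ} (h : NearIndicator f Y L δ)
    (hδ : δ ≤ 1 / 32) (k : ℕ) : NearIndicator (idempotentApprox k f) Y L (16 * δ) := by
  intro y hy
  have : _root_.idempotentApprox k f y = _root_.idempotentApprox k (f y) :=
    map_idempotentApprox (Pi.evalAlgHom ℂ (fun _ : X => ℂ) y) k f
  rw [this]
  exact ⟨fun hL => norm_idempotentApprox_sub_one_le hδ ((h y hy).1 hL) k,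
    fun hL => norm_idempotentApprox_le hδ ((h y hy).2 hL) k⟩

theorem NearIndicator.of_norm_sub_le {f f' : X → ℂ} {δ η ε : ℝ} (h : NearIndicator f Y L δ)
    (hf : ∀ y ∈ Y, ‖f' y - f y‖ ≤ η) (hε : δ + η ≤ ε) : NearIndicator f' Y L ε := by
  refine fun y hy => ⟨fun hL => ?_, fun hL => ?_⟩
  · have := norm_add_le_of_le ((h y hy).1 hL) (hf y hy)
    rw [show f y - 1 + (f' y - f y) = f' y - 1 by ring] at this
    exact this.trans hε
  · have := norm_add_le_of_le ((h y hy).2 hL) (hf y hy)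
    rw [add_sub_cancel] at this
    exact this.trans hε

theorem CharactersInSet.exists_nearIndicator_of_laurent (hA : CharactersInSet A Y) (hg : g ∈ A)
    {ε : ℝ} (hε : 0 < ε)
    (hin : ∀ δ > 0, ∃ f ∈ A, NearIndicator f {y ∈ Y | ‖g y‖ ≤ 2} L δ)
    (hout : ∀ δ > 0, ∃ f ∈ adjoinInv A g hg, NearIndicator f {y ∈ Y | 1 ≤ ‖g y‖} L δ) :
    ∃ f ∈ A, NearIndicator f Y L ε := by
  set δ := min (ε / 32) (1 / 64) with hδ
  have hδ0 : 0 < δ := by positivity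
  have hδ1 : δ ≤ 1 / 64 := min_le_right _ _
  have hδ2 : δ ≤ ε / 32 := min_le_left _ _
  obtain ⟨f₁, hf₁, h₁⟩ := hin δ hδ0
  obtain ⟨f₂, hf₂, h₂⟩ := hout δ hδ0
  have hle := adjoinInv_le_laurentAlgebra hA hg
  let incl : adjoinInv A g hg →ₐ[ℂ] laurentAlgebra A Y g := Subalgebra.inclusion hle
  let x₁ : laurentAlgebra A Y g := ⟨f₁, hle (le_adjoinInv hg hf₁)⟩
  let x₂ : laurentAlgebra A Y g := ⟨f₂, hle hf₂⟩
  have hlim := (laurentSeminorm A Y g).tendsto_idempotentApprox_sub laurentSeminorm_smul_le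
    (laurentSeminorm_le (LaurentBound.of_mem A.one_mem zero_le_one fun y _ => by simp)) x₁ x₂ <| by
    intro φ hφ
    obtain ⟨y, hy, hgy, h⟩ := hA.exists_point_adjoinInv hg (φ.comp incl)
      (fun a ha C hC haC => (hφ _).trans (laurentSeminorm_le (LaurentBound.of_mem ha hC haC)))
      (fun a b hab => by
        have := (hφ (incl a - incl b)).trans (laurentSeminorm_le (C := 0)
          ((LaurentBound.of_mem A.zero_mem le_rfl fun y _ => by simp).congr
            (fun y hy hy0 => (sub_eq_zero.2 (hab y hy hy0)).symm) le_rfl))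
        rwa [norm_le_zero_iff, map_sub, sub_eq_zero] at this)
      ((hφ _).trans (laurentSeminorm_le
        ((LaurentBound.term 1 (-1) 1 A.one_mem zero_le_one fun y _ => by simp).congr
          (fun y _ _ => by simp [incl]) (by simp))))
    have hgy2 : ‖g y‖ ≤ 2 := by
      have hgy' : φ (incl ⟨g, le_adjoinInv hg hg⟩) = g y := h ⟨g, le_adjoinInv hg hg⟩
      rw [← hgy']
      refine (hφ _).trans (laurentSeminorm_le ?_)
      exact (LaurentBound.term 1 1 1 A.one_mem zero_le_one fun y _ => by simp).congr
        (fun y _ _ => by simp [incl]) (by simp)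
    have e₁ : φ x₁ = f₁ y := h ⟨f₁, le_adjoinInv hg hf₁⟩
    have e₂ : φ x₂ = f₂ y := h ⟨f₂, hf₂⟩
    rw [e₁, e₂]
    by_cases hL : y ∈ L
    · exact .inr ⟨((h₁ y ⟨hy, hgy2⟩).1 hL).trans hδ1, ((h₂ y ⟨hy, hgy⟩).1 hL).trans hδ1⟩
    · exact .inl ⟨((h₁ y ⟨hy, hgy2⟩).2 hL).trans hδ1, ((h₂ y ⟨hy, hgy⟩).2 hL).trans hδ1⟩
  obtain ⟨k, hk⟩ := (hlim.eventually_lt_const (half_pos hε)).exists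
  obtain ⟨u, hu, v, huv, hu', hv'⟩ := (exists_laurentBound_of_lt hk).exists_split hg
  have hsub : ∀ y ∈ Y, g y ≠ 0 →
      idempotentApprox k f₁ y - u y = idempotentApprox k f₂ y + v y := by
    intro y hy hy0
    have h1 := map_idempotentApprox (laurentAlgebra A Y g).val k x₁
    have h2 := map_idempotentApprox (laurentAlgebra A Y g).val k x₂
    have := huv y hy hy0
    have h1' := congrFun h1 y
    have h2' := congrFun h2 y
    change _ = idempotentApprox k f₁ y at h1'
    change _ = idempotentApprox k f₂ y at h2'
    rw [← h1', ← h2', sub_eq_iff_eq_add, add_assoc, add_comm (v y), ← this]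
    simp
  have hmem : idempotentApprox k f₁ ∈ A := by
    have := map_idempotentApprox A.val k ⟨f₁, hf₁⟩
    change _ = idempotentApprox k f₁ at this
    rw [← this]
    exact Subtype.property _
  refine ⟨idempotentApprox k f₁ - u, A.sub_mem hmem hu, fun y hy => ?_⟩
  rcases le_total ‖g y‖ 2 with hgy | hgy
  · refine ((h₁.idempotentApprox (by linarith) k).of_norm_sub_le (η := ε / 2) (ε := ε)
      (f' := idempotentApprox k f₁ - u) (fun y hy => ?_) (by linarith)) y ⟨hy, hgy⟩
    simpa using hu' y hy.1 hy.2
  · have hgy1 : 1 ≤ ‖g y‖ := one_le_two.trans hgy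
    refine ((h₂.idempotentApprox (by linarith) k).of_norm_sub_le (η := ε / 2) (ε := ε)
      (f' := idempotentApprox k f₁ - u) (fun y hy => ?_) (by linarith)) y ⟨hy, hgy1⟩
    rw [Pi.sub_apply, hsub y hy.1 (norm_pos_iff.1 (zero_lt_one.trans_le hy.2)), add_sub_cancel_left]
    exact hv' y hy.1 hy.2

end

theorem CharactersInSet.exists_nearIndicator {X : Type*} (l : List (X → ℂ))
    {A : Subalgebra ℂ (X → ℂ)} {Y L : Set X} (hA : CharactersInSet A Y) (hl : ∀ g ∈ l, g ∈ A)
    (hsep : ∀ x ∈ Y, x ∈ L → ∀ y ∈ Y, y ∉ L →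
      ∃ g ∈ l, (‖g x‖ < 1 ∧ 2 < ‖g y‖) ∨ (2 < ‖g x‖ ∧ ‖g y‖ < 1))
    {ε : ℝ} (hε : 0 < ε) : ∃ f ∈ A, NearIndicator f Y L ε := by
  induction l generalizing A Y ε with
  | nil =>
    by_cases h : ∃ x ∈ Y, x ∈ L
    · obtain ⟨x, hx, hxL⟩ := h
      refine ⟨1, A.one_mem, fun y hy => ⟨fun _ => by simp [hε.le], fun hyL => ?_⟩⟩
      simpa using hsep x hx hxL y hy hyL
    · exact ⟨0, A.zero_mem, fun y hy =>
        ⟨fun hyL => (h ⟨y, hy, hyL⟩).elim, fun _ => by simp [hε.le]⟩⟩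
  | cons g l ih =>
    have hg : g ∈ A := hl g (by simp)
    have hl' : ∀ g ∈ l, g ∈ A := fun g hg => hl g (by simp [hg])
    refine hA.exists_nearIndicator_of_laurent hg hε (fun δ hδ => ?_) (fun δ hδ => ?_)
    · refine ih (hA.sublevel hg) hl' (fun x hx hxL y hy hyL => ?_) hδ
      obtain ⟨g', hg', h⟩ := hsep x hx.1 hxL y hy.1 hyL
      rcases List.mem_cons.1 hg' with rfl | hg'
      · exact absurd h (by have := hx.2; have := hy.2; rintro (h | h) <;> linarith)
      · exact ⟨g', hg', h⟩
    · refine ih (hA.superlevel hg) (fun g' hg' => le_adjoinInv hg (hl' g' hg'))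
        (fun x hx hxL y hy hyL => ?_) hδ
      obtain ⟨g', hg', h⟩ := hsep x hx.1 hxL y hy.1 hyL
      rcases List.mem_cons.1 hg' with rfl | hg'
      · exact absurd h (by have := hx.2; have := hy.2; rintro (h | h) <;> linarith)
      · exact ⟨g', hg', h⟩

theorem Complex.norm_sub_sub_mul_deriv_le {ψ : ℂ → ℂ} (hψ : Differentiable ℂ ψ) {C : ℝ}
    (hC : ∀ z, ‖z‖ ≤ 3 → ‖ψ z‖ ≤ C) {s : ℂ} (hs : ‖s‖ ≤ 1) :
    ‖ψ s - ψ 0 - s * deriv ψ 0‖ ≤ C * ‖s‖ ^ 2 := by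
  have hd : ∀ {F : ℂ → ℂ} (_ : Differentiable ℂ F) {r : ℝ} (_ : ∀ z, ‖z‖ ≤ r + 1 → ‖F z‖ ≤ C),
      ∀ z, ‖z‖ ≤ r → ‖deriv F z‖ ≤ C := by
    intro F hF r hr z hz
    have := norm_deriv_le_of_forall_mem_sphere_norm_le (f := F) (c := z) one_pos hF.diffContOnCl
      (fun w hw => hr w ?_)
    · simpa using this
    · have := norm_add_le_of_le hz (mem_sphere_iff_norm.1 hw).le
      rwa [add_sub_cancel] at this
  have hd' : Differentiable ℂ (deriv ψ) := hψ.deriv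
  have h2 := hd hd' (r := 1) (hd hψ (r := 1 + 1) (fun z hz => hC z (hz.trans (by norm_num))))
  have hs0 : (0 : ℂ) ∈ Metric.closedBall (0 : ℂ) ‖s‖ := by simp
  have hs1 : s ∈ Metric.closedBall (0 : ℂ) ‖s‖ := by simp
  have h1 : ∀ z ∈ Metric.closedBall (0 : ℂ) ‖s‖, ‖deriv ψ z - deriv ψ 0‖ ≤ C * ‖s‖ := by
    intro z hz
    have hz' : ‖z‖ ≤ ‖s‖ := by simpa using hz
    have := (convex_closedBall (0 : ℂ) ‖s‖).norm_image_sub_le_of_norm_deriv_le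
      (f := deriv ψ) (C := C) (fun x _ => hd'.differentiableAt)
      (fun x hx => h2 x ((mem_closedBall_zero_iff.1 hx).trans hs)) hs0 hz
    refine this.trans ?_
    rw [sub_zero]
    have : 0 ≤ C := (norm_nonneg _).trans (hC 0 (by simp))
    gcongr
  have h0 := (convex_closedBall (0 : ℂ) ‖s‖).norm_image_sub_le_of_norm_hasDerivWithin_le
      (f := fun z => ψ z - z * deriv ψ 0) (f' := fun z => deriv ψ z - deriv ψ 0) (C := C * ‖s‖)
      (fun x _ => by
        simpa using (hψ x).hasDerivAt.hasDerivWithinAt.fun_sub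
          ((hasDerivAt_id x).mul_const (deriv ψ 0)).hasDerivWithinAt) h1 hs0 hs1
  simp only [zero_mul, sub_zero] at h0
  rw [sq, ← mul_assoc]
  rwa [sub_right_comm]

/-- The algebra of entire functions. -/
def entireFunctions (n : ℕ) : Subalgebra ℂ (EuclideanSpace ℂ (Fin n) → ℂ) where
  carrier := {f | Differentiable ℂ f}
  mul_mem' := Differentiable.mul
  add_mem' := Differentiable.add
  algebraMap_mem' c := differentiable_const c

theorem norm_sub_sub_mul_fderiv_le {E : Type*} [NormedAddCommGroup E] [NormedSpace ℂ E] {f : E → ℂ}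
    (hf : Differentiable ℂ f) {w u : E} {C : ℝ} (hC : ∀ z : ℂ, ‖z‖ ≤ 3 → ‖f (w + z • u)‖ ≤ C)
    {s : ℂ} (hs : ‖s‖ ≤ 1) : ‖f (w + s • u) - f w - s * fderiv ℂ f w u‖ ≤ C * ‖s‖ ^ 2 := by
  have hd : Differentiable ℂ fun z : ℂ => f (w + z • u) := by fun_prop
  have := Complex.norm_sub_sub_mul_deriv_le hd hC hs
  have h0 : HasDerivAt (fun z : ℂ => f (w + z • u)) (fderiv ℂ f w u) 0 := by
    have h1 : HasDerivAt (fun z : ℂ => w + z • u) u 0 := by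
      simpa using ((hasDerivAt_id (0 : ℂ)).smul_const u).const_add w
    have h2 : HasFDerivAt f (fderiv ℂ f w) (w + (0 : ℂ) • u) := by
      simpa using (hf w).hasFDerivAt
    exact h2.comp_hasDerivAt 0 h1
  simpa [h0.deriv] using this

theorem eq_of_norm_sub_le_sq {c : ℝ → ℂ} {C : ℝ}
    (h : ∀ t s : ℝ, 0 ≤ t → t ≤ 1 → 0 ≤ s → s ≤ 1 → ‖c (t + s) - c t‖ ≤ C * s ^ 2) : c 1 = c 0 := by
  have key : ∀ N : ℕ, ‖c 1 - c 0‖ ≤ C / (N + 1 : ℕ) := by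
    intro N
    have hN : (0 : ℝ) < (N + 1 : ℕ) := by positivity
    have : ∀ k ≤ N + 1, ‖c (k / (N + 1 : ℕ)) - c 0‖ ≤ k * (C * (1 / (N + 1 : ℕ)) ^ 2) := by
      intro k hk
      induction k with
      | zero => simp
      | succ k ih =>
        have := norm_add_le_of_le (ih (by lia)) (h (k / (N + 1 : ℕ)) (1 / (N + 1 : ℕ))
          (by positivity) ((div_le_one hN).2 (by exact_mod_cast (by lia : k ≤ N + 1)))
          (by positivity) ((div_le_one hN).2 (by exact_mod_cast (by lia : 1 ≤ N + 1))))
        rw [← add_div, sub_add_sub_cancel'] at this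
        push_cast at this ⊢
        linarith
    have := this (N + 1) le_rfl
    rw [div_self hN.ne'] at this
    refine this.trans_eq ?_
    field_simp
  have hlim : Tendsto (fun N : ℕ => C / (N + 1 : ℕ)) atTop (𝓝 0) :=
    (tendsto_add_atTop_iff_nat 1).2 (tendsto_const_div_atTop_nhds_zero_nat C)
  exact sub_eq_zero.1 (norm_le_zero_iff.1 (ge_of_tendsto' hlim key))

theorem exists_forall_eq_apply_of_entireFunctions {n : ℕ} {K : Set (EuclideanSpace ℂ (Fin n))}
    (hK : IsCompact K) (φ : entireFunctions n →ₐ[ℂ] ℂ)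
    (hφ : ∀ (a : entireFunctions n) (C : ℝ), 0 ≤ C →
      (∀ y ∈ K, ‖(a : EuclideanSpace ℂ (Fin n) → ℂ) y‖ ≤ C) → ‖φ a‖ ≤ C) :
    ∃ P, ∀ a : entireFunctions n, φ a = (a : EuclideanSpace ℂ (Fin n) → ℂ) P := by
  let x (i : Fin n) : entireFunctions n :=
    ⟨fun z => z i, show Differentiable ℂ (fun z : EuclideanSpace ℂ (Fin n) => z i) by fun_prop⟩
  let P : EuclideanSpace ℂ (Fin n) := WithLp.toLp 2 fun i => φ (x i)
  refine ⟨P, fun ⟨f, hf⟩ => ?_⟩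
  replace hf : Differentiable ℂ f := hf
  let u (t : ℝ) (e : EuclideanSpace ℂ (Fin n)) : entireFunctions n :=
    ⟨fun z => f (P + (t : ℂ) • (z - P) + e),
      show Differentiable ℂ (fun z => f (P + (t : ℂ) • (z - P) + e)) by fun_prop⟩
  obtain ⟨D, hD1, hD⟩ := hK.isBounded.subset_closedBall_lt 1 P
  obtain ⟨C, hC⟩ :=
    (isCompact_closedBall P (4 * D)).exists_bound_of_continuousOn hf.continuous.continuousOn
  have hC0 : 0 ≤ C := (norm_nonneg _).trans (hC P (by simp; linarith))
  have hx (i : Fin n) : φ (x i - algebraMap ℂ _ (P i)) = 0 := by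
    rw [map_sub, AlgHom.commutes]
    exact sub_self _
  let e (i : Fin n) : EuclideanSpace ℂ (Fin n) := EuclideanSpace.single i 1
  have key : φ (u 1 0) = φ (u 0 0) := by
    refine eq_of_norm_sub_le_sq (c := fun t => φ (u t 0)) (C := C + n * (D * C)) ?_
    intro t s ht0 ht1 hs0 hs1
    let G : entireFunctions n := u (t + s) 0 - u t 0 -
      ∑ i, (x i - algebraMap ℂ _ (P i)) * (u t ((s : ℂ) • e i) - u t 0)
    have hG : φ (u (t + s) 0) - φ (u t 0) = φ G := by
      rw [map_sub φ (u (t + s) 0 - u t 0), map_sum, Finset.sum_eq_zero, sub_zero, map_sub]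
      intro i _
      rw [map_mul, hx, zero_mul]
    have hs : ‖(s : ℂ)‖ ≤ 1 := by simpa [abs_of_nonneg hs0] using hs1
    simp only [hG]
    refine hφ G _ (by positivity) fun z hz => ?_
    set v := z - P with hv
    set w := P + (t : ℂ) • v with hw
    have hvD : ‖v‖ ≤ D := by simpa [dist_eq_norm] using hD hz
    have hvi (i : Fin n) : ‖v i‖ ≤ D := (PiLp.norm_apply_le v i).trans hvD
    have hT : ∀ y : EuclideanSpace ℂ (Fin n), ‖y‖ ≤ D →
        ‖f (w + (s : ℂ) • y) - f w - s * fderiv ℂ f w y‖ ≤ C * s ^ 2 := by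
      intro y hy
      have := norm_sub_sub_mul_fderiv_le hf (w := w) (u := y) (C := C) (s := s)
        (fun ζ hζ => hC _ ?_) hs
      · simpa using this
      · rw [mem_closedBall_iff_norm, hw, add_assoc, add_sub_cancel_left]
        have h1 : ‖(t : ℂ) • v‖ ≤ 1 * D := by
          rw [norm_smul]
          gcongr
          simpa [abs_of_nonneg ht0] using ht1
        have h2 : ‖ζ • y‖ ≤ 3 * D := by
          rw [norm_smul]
          gcongr
        exact (norm_add_le_of_le h1 h2).trans_eq (by ring)
    have hsum : fderiv ℂ f w v = ∑ i, v i * fderiv ℂ f w (e i) := by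
      have : v = ∑ i, v i • e i := by
        ext j
        simp [e, Finset.sum_apply, Pi.single_apply]
      conv_lhs => rw [this]
      simp [map_sum]
    have hGz : (G : EuclideanSpace ℂ (Fin n) → ℂ) z =
        (f (w + (s : ℂ) • v) - f w - s * fderiv ℂ f w v) -
          ∑ i, v i * (f (w + (s : ℂ) • e i) - f w - s * fderiv ℂ f w (e i)) := by
      have h1 : (G : EuclideanSpace ℂ (Fin n) → ℂ) z = f (w + (s : ℂ) • v) - f w -
          ∑ i, v i * (f (w + (s : ℂ) • e i) - f w) := by
        simp [G, u, x, hw, hv, add_smul, add_assoc, Finset.sum_apply]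
      rw [h1, hsum, Finset.mul_sum, sub_sub _ (Finset.sum _ _) (Finset.sum _ _),
        ← Finset.sum_add_distrib]
      congr 1
      refine Finset.sum_congr rfl fun i _ => ?_
      ring
    rw [hGz, add_mul]
    refine norm_sub_le_of_le (hT v hvD) ?_
    refine (norm_sum_le_of_le (f := fun i => _) (n := fun _ => D * C * s ^ 2) Finset.univ
      fun i _ => ?_).trans_eq (by simp [mul_assoc])
    rw [norm_mul, mul_assoc]
    exact mul_le_mul (hvi i) (hT (e i) (by simpa [e] using hD1.le)) (norm_nonneg _) (by linarith)
  have h1 : u 1 0 = ⟨f, hf⟩ := by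
    ext z
    simp [u]
  have h0 : u 0 0 = algebraMap ℂ _ (f P) := by
    ext z
    simp [u]
  rw [h1, h0, AlgHom.commutes] at key
  exact key

/-- The functions which on `K` are quotients of entire functions, the denominator having no zeros
in `K`. -/
def entireQuotients {n : ℕ} (K : Set (EuclideanSpace ℂ (Fin n))) :
    Subalgebra ℂ (EuclideanSpace ℂ (Fin n) → ℂ) where
  carrier := {f | ∃ p h : EuclideanSpace ℂ (Fin n) → ℂ, Differentiable ℂ p ∧ Differentiable ℂ h ∧
    (∀ z ∈ K, h z ≠ 0) ∧ ∀ z ∈ K, f z * h z = p z}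
  mul_mem' := by
    rintro f f' ⟨p, h, hp, hh, h0, hf⟩ ⟨p', h', hp', hh', h0', hf'⟩
    refine ⟨p * p', h * h', hp.mul hp', hh.mul hh', fun z hz => mul_ne_zero (h0 z hz) (h0' z hz),
      fun z hz => ?_⟩
    simp only [Pi.mul_apply, ← hf z hz, ← hf' z hz]
    ring
  add_mem' := by
    rintro f f' ⟨p, h, hp, hh, h0, hf⟩ ⟨p', h', hp', hh', h0', hf'⟩
    refine ⟨p * h' + p' * h, h * h', (hp.mul hh').add (hp'.mul hh), hh.mul hh',
      fun z hz => mul_ne_zero (h0 z hz) (h0' z hz), fun z hz => ?_⟩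
    simp only [Pi.mul_apply, Pi.add_apply, ← hf z hz, ← hf' z hz]
    ring
  algebraMap_mem' c := ⟨fun _ => c, 1, differentiable_const c, differentiable_const 1,
    fun _ _ => one_ne_zero, fun _ _ => mul_one c⟩

theorem entireFunctions_le_entireQuotients {n : ℕ} (K : Set (EuclideanSpace ℂ (Fin n))) :
    entireFunctions n ≤ entireQuotients K :=
  fun f hf => ⟨f, 1, hf, differentiable_const 1, fun _ _ => one_ne_zero, fun z _ => mul_one (f z)⟩

theorem PrincipalConvex.charactersInSet {n : ℕ} {K : Set (EuclideanSpace ℂ (Fin n))}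
    (hK : PrincipalConvex K) (hKc : IsCompact K) : CharactersInSet (entireQuotients K) K where
  bounded := by
    rintro f ⟨p, h, hp, hh, h0, hf⟩
    obtain ⟨C, hC⟩ := hKc.exists_bound_of_continuousOn
      (hp.continuous.continuousOn.div hh.continuous.continuousOn h0)
    refine ⟨C, fun z hz => ?_⟩
    rw [eq_div_of_mul_eq (h0 z hz) (hf z hz)]
    exact hC z hz
  exists_point φ hφ := by
    have hle := entireFunctions_le_entireQuotients K
    have hφeq : ∀ a b : entireQuotients K,
        (∀ z ∈ K, (a : EuclideanSpace ℂ (Fin n) → ℂ) z = (b : EuclideanSpace ℂ (Fin n) → ℂ) z) →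
          φ a = φ b := by
      intro a b hab
      have := hφ (a - b) 0 le_rfl fun z hz => by simp [hab z hz]
      rwa [norm_le_zero_iff, map_sub, sub_eq_zero] at this
    obtain ⟨P, hP⟩ := exists_forall_eq_apply_of_entireFunctions hKc
      (φ.comp (Subalgebra.inclusion hle)) fun a C hC haC => hφ _ C hC haC
    have hP (f : EuclideanSpace ℂ (Fin n) → ℂ) (hf : Differentiable ℂ f) : φ ⟨f, hle hf⟩ = f P :=
      hP ⟨f, hf⟩
    have hPK : P ∈ K := by
      by_contra hPK
      obtain ⟨f, hf, hfP, hfK⟩ := hK P hPK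
      let f' : entireQuotients K := ⟨f⁻¹, 1, f, differentiable_const 1, hf, hfK,
        fun z hz => inv_mul_cancel₀ (hfK z hz)⟩
      have := hφeq (f' * ⟨f, hle hf⟩) 1 fun z hz => inv_mul_cancel₀ (hfK z hz)
      rw [map_mul, map_one, hP f hf, hfP, mul_zero] at this
      exact zero_ne_one this
    refine ⟨P, hPK, fun a => ?_⟩
    obtain ⟨p, h, hp, hh, h0, ha⟩ := a.2
    have := hφeq (a * ⟨h, hle hh⟩) ⟨p, hle hp⟩ ha
    rw [map_mul, hP p hp, hP h hh, ← ha P hPK] at this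
    exact mul_right_cancel₀ (h0 P hPK) this

theorem exists_list_separating {n : ℕ} {L M : Set (EuclideanSpace ℂ (Fin n))} (hL : IsCompact L)
    (hM : IsCompact M) (hdisj : Disjoint L M) :
    ∃ l : List (EuclideanSpace ℂ (Fin n) → ℂ), (∀ g ∈ l, Differentiable ℂ g) ∧
      ∀ x ∈ L, ∀ y ∈ M, ∃ g ∈ l, ‖g x‖ < 1 ∧ 2 < ‖g y‖ := by
  classical
  let ι := {g : EuclideanSpace ℂ (Fin n) → ℂ // Differentiable ℂ g}
  have hopen (g : ι) : IsOpen {q : EuclideanSpace ℂ (Fin n) × EuclideanSpace ℂ (Fin n) |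
      ‖g.1 q.1‖ < 1 ∧ 2 < ‖g.1 q.2‖} := by
    have hc := g.2.continuous
    exact (isOpen_lt (hc.comp continuous_fst).norm continuous_const).inter
      (isOpen_lt continuous_const (hc.comp continuous_snd).norm)
  obtain ⟨t, ht⟩ := (hL.prod hM).elim_finite_subcover _ hopen (by
    rintro ⟨x, y⟩ ⟨hx, hy⟩
    have hxy : x ≠ y := hdisj.ne_of_mem hx hy
    obtain ⟨i, hi⟩ : ∃ i, x i ≠ y i := by
      by_contra! h
      exact hxy (PiLp.ext h)
    refine Set.mem_iUnion.2 ⟨⟨fun z => 3 * ((z i - x i) / (y i - x i)), by fun_prop⟩, ?_⟩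
    have : (y i - x i) / (y i - x i) = 1 := div_self (sub_ne_zero.2 hi.symm)
    simp only [Set.mem_ofPred_eq, this, sub_self]
    norm_num)
  refine ⟨t.toList.map Subtype.val, fun g hg => ?_, fun x hx y hy => ?_⟩
  · obtain ⟨g', _, rfl⟩ := List.mem_map.1 hg
    exact g'.2
  · obtain ⟨g, hg, h⟩ := Set.mem_iUnion₂.1 (ht (Set.mk_mem_prod hx hy))
    exact ⟨g, List.mem_map_of_mem (Finset.mem_toList.2 hg), h⟩

theorem PrincipalConvex.left_of_union {n : ℕ} {L M : Set (EuclideanSpace ℂ (Fin n))}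
    (hK : PrincipalConvex (L ∪ M)) (hL : IsCompact L) (hM : IsCompact M) (hdisj : Disjoint L M) :
    PrincipalConvex L := by
  intro b hb
  by_cases hbM : b ∈ M
  · obtain ⟨l, hl, hsep⟩ := exists_list_separating hL hM hdisj
    obtain ⟨a, ⟨p, h, hp, hh, h0, ha⟩, hind⟩ :=
      (hK.charactersInSet (hL.union hM)).exists_nearIndicator (L := L) l
        (fun g hg => entireFunctions_le_entireQuotients _ (hl g hg))
        (fun x _ hxL y hy hyL => by
          obtain ⟨g, hg, h⟩ := hsep x hxL y (hy.resolve_left hyL)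
          exact ⟨g, hg, .inl h⟩) (ε := 1 / 4) (by norm_num)
    refine ⟨fun z => p z - a b * h z, hp.sub (hh.const_mul _), sub_eq_zero.2 (ha b (.inr hbM)).symm,
      fun z hz hz0 => ?_⟩
    beta_reduce at hz0
    rw [← ha z (.inl hz), ← sub_mul] at hz0
    have hab : a z = a b :=
      sub_eq_zero.1 ((mul_eq_zero.1 hz0).resolve_right (h0 z (.inl hz)))
    have h1 := (hind z (.inl hz)).1 hz
    have h2 := (hind b (.inr hbM)).2 hb
    rw [hab] at h1
    have := norm_sub_le_of_le h2 h1
    rw [sub_sub_cancel, norm_one] at this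
    norm_num at this
  · obtain ⟨f, hf, hfb, hfK⟩ := hK b (by simp [hb, hbM])
    exact ⟨f, hf, hfb, fun z hz => hfK z (.inl hz)⟩

/-- if a compact `K ⊂ ℂⁿ` convex with respect to principal hypersurfaces is
the disjoint union of compact sets `L` and `M`, then `L` and `M` are themselves convex
with respect to principal hypersurfaces. -/
theorem stmt5 (n : ℕ) (hn : 1 ≤ n) (K L M : Set (EuclideanSpace ℂ (Fin n)))
    (hKc : IsCompact K) (hK : PrincipalConvex K)
    (hLc : IsCompact L) (hMc : IsCompact M)
    (hdisj : Disjoint L M) (hunion : K = L ∪ M) :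
    PrincipalConvex L ∧ PrincipalConvex M := by
  subst hunion
  refine ⟨hK.left_of_union hLc hMc hdisj, ?_⟩
  rw [Set.union_comm] at hK
  exact hK.left_of_union hMc hLc hdisj.symm
end

section
/- Let n ≥ 1, let K ⊂ ℂⁿ be a compact set that is convex with respect to principal hypersurfaces, and let U ⊆ ℂⁿ be an open set containing K. Then there exists an open set Ω with K ⊆ Ω, such that the closure of Ω is compact, contained in U, and is itself convex with respect to principal hypersurfaces. -/
open Complex

/-- The set of local maximum values of a real function on a second countable space is countable. -/
lemma countable_localMax_values {X : Type*} [TopologicalSpace X] [SecondCountableTopology X]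
    (φ : X → ℝ) : {t : ℝ | ∃ a, IsLocalMax φ a ∧ φ a = t}.Countable := by
  refine ((TopologicalSpace.countable_countableBasis X).image fun V => sSup (φ '' V)).mono ?_
  rintro t ⟨a, ha, rfl⟩
  obtain ⟨V, hV, haV, hsub⟩ :=
    (TopologicalSpace.isBasis_countableBasis X).mem_nhds_iff.1 ha
  refine ⟨V, hV, IsGreatest.csSup_eq ⟨⟨a, haV, rfl⟩, ?_⟩⟩
  rintro _ ⟨z, hz, rfl⟩
  exact hsub hz

/-- For all but countably many levels, the closure of a strict superlevel set of a continuous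
function is the corresponding weak superlevel set. -/
lemma exists_closure_superlevel_eq {X : Type*} [TopologicalSpace X] [SecondCountableTopology X]
    {φ : X → ℝ} (hφ : Continuous φ) {α β : ℝ} (hαβ : α < β) :
    ∃ t ∈ Set.Ioo α β, closure {z | t < φ z} = {z | t ≤ φ z} := by
  obtain ⟨t, ht, hmax⟩ : ∃ t ∈ Set.Ioo α β, t ∉ {t : ℝ | ∃ a, IsLocalMax φ a ∧ φ a = t} := by
    by_contra! h
    refine Cardinal.Real.Ioo_countable_iff.not.2 (not_le.2 hαβ) ?_
    exact (countable_localMax_values φ).mono h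
  refine ⟨t, ht, Set.Subset.antisymm ?_ fun a ha => ?_⟩
  · exact closure_minimal (fun z (hz : t < φ z) => hz.le) (isClosed_le continuous_const hφ)
  · rcases (show t ≤ φ a from ha).lt_or_eq with h | h
    · exact subset_closure h
    · by_contra hcl
      refine hmax ⟨a, ?_, h.symm⟩
      filter_upwards [isClosed_closure.isOpen_compl.mem_nhds hcl] with z hz
      rw [← h]
      exact not_lt.1 fun hlt => hz (subset_closure hlt)

/-- All weak superlevel sets of `φ` are convex with respect to principal hypersurfaces. -/
def SuperlevelsPrincipalConvex {n : ℕ} (φ : EuclideanSpace ℂ (Fin n) → ℝ) : Prop :=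
  ∀ t, PrincipalConvex {z | t ≤ φ z}

namespace SuperlevelsPrincipalConvex

variable {n : ℕ}

lemma const (c : ℝ) :
    SuperlevelsPrincipalConvex fun _ : EuclideanSpace ℂ (Fin n) => c := fun _ _ ha =>
  ⟨fun _ => 0, differentiable_const _, rfl, fun _ hz => absurd hz ha⟩

lemma norm {f : EuclideanSpace ℂ (Fin n) → ℂ} (hf : Differentiable ℂ f) :
    SuperlevelsPrincipalConvex fun z => ‖f z‖ := fun t a ha =>
  ⟨fun z => f z - f a, hf.sub_const _, sub_self _, fun z (hz : t ≤ ‖f z‖) h =>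
    ha (show t ≤ ‖f a‖ from sub_eq_zero.1 h ▸ hz)⟩

lemma const_sub_norm (R : ℝ) :
    SuperlevelsPrincipalConvex fun z : EuclideanSpace ℂ (Fin n) => R - ‖z‖ := fun t a ha => by
  refine ⟨fun z => innerSL ℂ a z - innerSL ℂ a a,
    (innerSL ℂ a).differentiable.sub_const _, sub_self _, fun z hz h => ?_⟩
  simp only [Set.mem_ofPred_eq, not_le] at ha hz
  have hle : ‖inner ℂ a z‖ ≤ ‖a‖ * ‖z‖ := norm_inner_le_norm a z
  have heq : inner ℂ a z = inner ℂ a a := sub_eq_zero.1 h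
  rw [heq, inner_self_eq_norm_sq_to_K] at hle
  simp only [norm_pow, RCLike.norm_ofReal, abs_norm] at hle
  nlinarith [norm_nonneg z]

lemma min {φ ψ : EuclideanSpace ℂ (Fin n) → ℝ} (hφ : SuperlevelsPrincipalConvex φ)
    (hψ : SuperlevelsPrincipalConvex ψ) :
    SuperlevelsPrincipalConvex fun z => min (φ z) (ψ z) := fun t a ha => by
  simp only [Set.mem_ofPred_eq, le_min_iff, not_and_or] at ha
  rcases ha with h | h
  · obtain ⟨f, hf, hfa, hne⟩ := hφ t a h
    exact ⟨f, hf, hfa, fun z hz => hne z (le_min_iff.1 (Set.mem_ofPred.1 hz)).1⟩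
  · obtain ⟨f, hf, hfa, hne⟩ := hψ t a h
    exact ⟨f, hf, hfa, fun z hz => hne z (le_min_iff.1 (Set.mem_ofPred.1 hz)).2⟩

end SuperlevelsPrincipalConvex

/-- A compact set convex with respect to principal hypersurfaces is separated from any disjoint
compact set by a continuous function whose superlevel sets are all convex. -/
lemma PrincipalConvex.exists_separating {n : ℕ} {K L : Set (EuclideanSpace ℂ (Fin n))}
    (hKc : IsCompact K) (hK : PrincipalConvex K) (hL : IsCompact L) (hKL : Disjoint L K) :
    ∃ φ : EuclideanSpace ℂ (Fin n) → ℝ, Continuous φ ∧ SuperlevelsPrincipalConvex φ ∧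
      (∀ z ∈ K, 2 ≤ φ z) ∧ ∀ z ∈ L, φ z ≤ 1 := by
  refine hL.induction_on (p := fun S => ∃ φ : EuclideanSpace ℂ (Fin n) → ℝ, Continuous φ ∧
    SuperlevelsPrincipalConvex φ ∧ (∀ z ∈ K, 2 ≤ φ z) ∧ ∀ z ∈ S, φ z ≤ 1) ?_ ?_ ?_ ?_
  · exact ⟨fun _ => 2, continuous_const, .const 2, fun _ _ => le_rfl, fun _ h => h.elim⟩
  · rintro S T hST ⟨φ, hc, hφ, hφK, hφT⟩
    exact ⟨φ, hc, hφ, hφK, fun z hz => hφT z (hST hz)⟩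
  · rintro S T ⟨φ, hc, hφ, hφK, hφS⟩ ⟨ψ, hc', hψ, hψK, hψT⟩
    refine ⟨fun z => min (φ z) (ψ z), hc.min hc', hφ.min hψ,
      fun z hz => le_min (hφK z hz) (hψK z hz), ?_⟩
    rintro z (hz | hz)
    · exact min_le_of_left_le (hφS z hz)
    · exact min_le_of_right_le (hψT z hz)
  · intro a ha
    obtain ⟨f, hf, hfa, hne⟩ := hK a (Set.disjoint_left.1 hKL ha)
    obtain ⟨δ, hδ, hle⟩ := hKc.exists_forall_le' hf.continuous.norm.continuousOn
      fun z hz => norm_pos_iff.2 (hne z hz)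
    have hc : Continuous fun z => ‖((2 / δ : ℝ) : ℂ) * f z‖ :=
      (continuous_const.mul hf.continuous).norm
    refine ⟨{z | ‖((2 / δ : ℝ) : ℂ) * f z‖ < 1}, mem_nhdsWithin_of_mem_nhds ?_,
      _, hc, .norm (hf.const_mul _), fun z hz => ?_, fun z hz => le_of_lt hz⟩
    · exact (isOpen_lt hc continuous_const).mem_nhds (by simp [hfa])
    · rw [norm_mul, Complex.norm_real, Real.norm_of_nonneg (by positivity)]
      calc (2 : ℝ) = 2 / δ * δ := by field_simp
        _ ≤ 2 / δ * ‖f z‖ := by gcongr; exact hle z hz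

/-- a compact `K ⊂ ℂⁿ` convex with respect to principal hypersurfaces admits,
inside any open `U ⊇ K`, an open neighborhood `Ω` whose closure is compact, contained in
`U`, and itself convex with respect to principal hypersurfaces. -/
theorem stmt6 (n : ℕ) (hn : 1 ≤ n) (K : Set (EuclideanSpace ℂ (Fin n)))
    (hKc : IsCompact K) (hK : PrincipalConvex K)
    (U : Set (EuclideanSpace ℂ (Fin n))) (hU : IsOpen U) (hKU : K ⊆ U) :
    ∃ Ω : Set (EuclideanSpace ℂ (Fin n)), IsOpen Ω ∧ K ⊆ Ω ∧
      IsCompact (closure Ω) ∧ closure Ω ⊆ U ∧ PrincipalConvex (closure Ω) := by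
  obtain ⟨R, hR⟩ := hKc.isBounded.subset_closedBall 0
  obtain ⟨φ, hc, hφ, hφK, hφL⟩ := hK.exists_separating hKc
    ((isCompact_closedBall (0 : EuclideanSpace ℂ (Fin n)) (R + 2)).diff hU)
    (Set.disjoint_left.2 fun z hz hzK => hz.2 (hKU hzK))
  have hcont : Continuous fun z => min (φ z) (R + 2 - ‖z‖) :=
    hc.min (continuous_const.sub continuous_norm)
  obtain ⟨t, ⟨ht1, ht2⟩, hcl⟩ := exists_closure_superlevel_eq hcont one_lt_two
  have hball : {z | t ≤ min (φ z) (R + 2 - ‖z‖)} ⊆ Metric.closedBall 0 (R + 2) := fun z hz => by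
    have := (le_min_iff.1 (Set.mem_ofPred.1 hz)).2
    rw [mem_closedBall_zero_iff]
    linarith
  refine ⟨{z | t < min (φ z) (R + 2 - ‖z‖)}, isOpen_lt continuous_const hcont, fun z hz => ?_, ?_⟩
  · have := mem_closedBall_zero_iff.1 (hR hz)
    exact lt_min (ht2.trans_le (hφK z hz)) (by linarith)
  · rw [hcl]
    refine ⟨(isCompact_closedBall 0 (R + 2)).of_isClosed_subset
      (isClosed_le continuous_const hcont) hball, fun z hz => ?_, hφ.min (.const_sub_norm _) t⟩
    by_contra hzU
    have := hφL z ⟨hball hz, hzU⟩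
    have := (le_min_iff.1 (Set.mem_ofPred.1 hz)).1
    linarith
end

section
/- Let n ≥ 1, let X ⊆ ℂⁿ be open, and let α : X × ℂⁿ → ℝ be continuous such that for each x ∈ X the map w ↦ α(x,w) is a quadratic form on ℂⁿ viewed as a real vector space and satisfies α(x, iw) = α(x, w). Let {Ω_j}_{j∈ℕ} be a locally finite open cover of X with each Ω_j having compact closure contained in X. For each j, let φ_j be a smooth real-valued function on an open neighborhood of closure(Ω_j) satisfying H_{φ_j}(x)(w) + α(x,w) ≥ 0 for all x ∈ Ω_j and w ∈ ℂⁿ, and let η_j > 0. Assume that for every k ∈ ℕ and every z in the boundary of Ω_k: (i) φ_k(z) < max{φ_j(z) : j with z ∈ Ω_j}, and (ii) φ_k(z) + η_k ≤ max{φ_j(z) − η_j : j with z ∈ Ω_j}. Then the function φ̃ defined by φ̃(z) = M_{(η_j)_{j∈J(z)}}((φ_j(z))_{j∈J(z)}), where J(z) = {j : z ∈ Ω_j} (a finite nonempty set), is well-defined, smooth on X, and satisfies H_{φ̃}(x)(w) + α(x,w) ≥ 0 for all x ∈ X and w ∈ ℂⁿ. -/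
open Complex MeasureTheory

/-- A regularizing kernel: a nonnegative smooth function on ℝ supported in `[-1,1]` with
total integral 1 and first moment 0. -/
structure IsRegKernel (θ : ℝ → ℝ) : Prop where
  smooth : ContDiff ℝ (⊤ : ℕ∞) θ
  nonneg : ∀ s, 0 ≤ θ s
  supp : Function.support θ ⊆ Set.Icc (-1) 1
  integral_one : (∫ s : ℝ, θ s) = 1
  integral_id : (∫ s : ℝ, s * θ s) = 0

/-- The regularized maximum over a finite index type:
`M_η(t) = ∫ max_j (t_j + η_j s_j) ∏_j θ(s_j) ds`. -/
noncomputable def regMaxI {ι : Type} [Fintype ι] (θ : ℝ → ℝ) (η t : ι → ℝ) : ℝ :=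
  ∫ s : ι → ℝ, (⨆ j, (t j + η j * s j)) * ∏ j, θ (s j)

open Filter Topology Set
open scoped ContDiff

/-! ### Regularized maxima -/

/-- The probability measure on `ℝ` with density `θ`. -/
noncomputable def kernelMeasure (θ : ℝ → ℝ) : Measure ℝ :=
  volume.withDensity fun s => ENNReal.ofReal (θ s)

theorem IsRegKernel.integrable {θ : ℝ → ℝ} (hθ : IsRegKernel θ) : Integrable θ :=
  Integrable.of_integral_ne_zero (by rw [hθ.integral_one]; exact one_ne_zero)

theorem IsRegKernel.kernelMeasure_apply {θ : ℝ → ℝ} (hθ : IsRegKernel θ) {s : Set ℝ}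
    (hs : MeasurableSet s) :
    kernelMeasure θ s = ENNReal.ofReal (∫ x, s.indicator θ x) := by
  rw [kernelMeasure, withDensity_apply _ hs, integral_indicator hs,
    ofReal_integral_eq_lintegral_ofReal hθ.integrable.integrableOn
      (Eventually.of_forall hθ.nonneg)]

theorem IsRegKernel.isProbabilityMeasure {θ : ℝ → ℝ} (hθ : IsRegKernel θ) :
    IsProbabilityMeasure (kernelMeasure θ) :=
  ⟨by simp [hθ.kernelMeasure_apply MeasurableSet.univ, hθ.integral_one]⟩

theorem IsRegKernel.ae_abs_le_one {θ : ℝ → ℝ} (hθ : IsRegKernel θ) :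
    ∀ᵐ s ∂kernelMeasure θ, |s| ≤ 1 := by
  rw [kernelMeasure, ae_withDensity_iff (by have := hθ.smooth.continuous; fun_prop)]
  refine Eventually.of_forall fun s hs => abs_le.2 (hθ.supp fun h => hs ?_)
  simp [h]

section Fintype

variable {ι : Type} [Fintype ι]

theorem IsRegKernel.integrable_prod {θ : ℝ → ℝ} (hθ : IsRegKernel θ) :
    Integrable fun s : ι → ℝ => ∏ j, θ (s j) :=
  Integrable.fintype_prod (f := fun _ : ι => θ) fun _ => hθ.integrable

theorem IsRegKernel.pi_kernelMeasure {θ : ℝ → ℝ} (hθ : IsRegKernel θ) :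
    Measure.pi (fun _ : ι => kernelMeasure θ) =
      volume.withDensity fun s : ι → ℝ => ENNReal.ofReal (∏ j, θ (s j)) := by
  have := hθ.isProbabilityMeasure
  refine Measure.pi_eq fun s hs => ?_
  have hm := MeasurableSet.univ_pi hs
  rw [withDensity_apply _ hm, ← ofReal_integral_eq_lintegral_ofReal
    hθ.integrable_prod.integrableOn
    (Eventually.of_forall fun s => Finset.prod_nonneg fun j _ => hθ.nonneg _),
    ← integral_indicator hm]
  simp_rw [fun j => hθ.kernelMeasure_apply (hs j)]
  rw [← ENNReal.ofReal_prod_of_nonneg fun j _ => integral_nonneg fun x =>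
    Set.indicator_nonneg (fun x _ => hθ.nonneg x) x,
    ← integral_fintype_prod_volume_eq_prod]
  congr 2
  ext x
  by_cases hx : x ∈ univ.pi s
  · rw [indicator_of_mem hx]
    exact Finset.prod_congr rfl fun j _ => (indicator_of_mem (hx j trivial) _).symm
  · rw [indicator_of_notMem hx]
    obtain ⟨j, hj⟩ : ∃ j, x j ∉ s j := by simpa using hx
    exact (Finset.prod_eq_zero (Finset.mem_univ j) (indicator_of_notMem hj _)).symm

theorem IsRegKernel.regMaxI_eq_integral {θ : ℝ → ℝ} (hθ : IsRegKernel θ) (η t : ι → ℝ) :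
    regMaxI θ η t =
      ∫ s, ⨆ j, (t j + η j * s j) ∂Measure.pi fun _ : ι => kernelMeasure θ := by
  have hc := hθ.smooth.continuous
  rw [hθ.pi_kernelMeasure, integral_withDensity_eq_integral_toReal_smul (by fun_prop)
    (Eventually.of_forall fun _ => ENNReal.ofReal_lt_top), regMaxI]
  refine integral_congr_ae (Eventually.of_forall fun s => ?_)
  simp only [smul_eq_mul]
  rw [ENNReal.toReal_ofReal (Finset.prod_nonneg fun j _ => hθ.nonneg _), mul_comm]

theorem IsRegKernel.ae_pi_abs_le_one {θ : ℝ → ℝ} (hθ : IsRegKernel θ) :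
    ∀ᵐ s ∂Measure.pi fun _ : ι => kernelMeasure θ, ∀ j, |s j| ≤ 1 := by
  have := hθ.isProbabilityMeasure
  exact ae_all_iff.2 fun j => 
    (Measure.tendsto_eval_ae_ae (μ := fun _ : ι => kernelMeasure θ)).eventually hθ.ae_abs_le_one

theorem continuous_ciSup_of_fintype {E : Type*} [TopologicalSpace E] {f : ι → E → ℝ}
    (hf : ∀ j, Continuous (f j)) : Continuous fun x => ⨆ j, f j x := by
  cases isEmpty_or_nonempty ι
  · simpa using continuous_const
  · simp_rw [← Finset.sup'_univ_eq_ciSup]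
    exact Continuous.finset_sup'_apply _ fun j _ => hf j

theorem IsRegKernel.integrable_ciSup {θ : ℝ → ℝ} (hθ : IsRegKernel θ) (η t : ι → ℝ) :
    Integrable (fun s => ⨆ j, (t j + η j * s j)) (Measure.pi fun _ : ι => kernelMeasure θ) := by
  have := hθ.isProbabilityMeasure
  refine Integrable.of_bound (C := ∑ j, (|t j| + |η j|))
    (continuous_ciSup_of_fintype fun j => by fun_prop).aestronglyMeasurable ?_
  filter_upwards [hθ.ae_pi_abs_le_one (ι := ι)] with s hs
  cases isEmpty_or_nonempty ι
  · simp
  obtain ⟨i, hi⟩ := exists_eq_ciSup_of_finite (f := fun j => t j + η j * s j)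
  rw [← hi, Real.norm_eq_abs]
  calc |t i + η i * s i| ≤ |t i| + |η i| * |s i| := by
        rw [← abs_mul]; exact abs_add_le _ _
    _ ≤ |t i| + |η i| := by
        gcongr
        exact mul_le_of_le_one_right (abs_nonneg _) (hs i)
    _ ≤ _ := Finset.single_le_sum (f := fun j => |t j| + |η j|)
        (fun j _ => by positivity) (Finset.mem_univ i)

theorem IsRegKernel.regMaxI_mono {θ : ℝ → ℝ} (hθ : IsRegKernel θ) (η : ι → ℝ) :
    Monotone (regMaxI θ η) := by
  intro t u h
  rw [hθ.regMaxI_eq_integral, hθ.regMaxI_eq_integral]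
  refine integral_mono (hθ.integrable_ciSup _ _) (hθ.integrable_ciSup _ _) fun s => ?_
  exact ciSup_mono (Set.finite_range _).bddAbove fun j => by linarith [h j]

theorem IsRegKernel.regMaxI_add_const {θ : ℝ → ℝ} (hθ : IsRegKernel θ) [Nonempty ι]
    (η t : ι → ℝ) (c : ℝ) :
    regMaxI θ η (fun j => t j + c) = regMaxI θ η t + c := by
  have := hθ.isProbabilityMeasure
  rw [hθ.regMaxI_eq_integral, hθ.regMaxI_eq_integral]
  have h (s : ι → ℝ) : ⨆ j, (t j + c + η j * s j) = (⨆ j, (t j + η j * s j)) + c := by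
    rw [ciSup_add (Set.finite_range _).bddAbove]
    exact iSup_congr fun j => by ring
  simp_rw [h]
  rw [integral_add (hθ.integrable_ciSup _ _) (integrable_const c)]
  simp

theorem IsRegKernel.convexOn_regMaxI {θ : ℝ → ℝ} (hθ : IsRegKernel θ) (η : ι → ℝ) :
    ConvexOn ℝ univ (regMaxI θ η) := by
  refine ⟨convex_univ, fun t _ u _ a b ha hb hab => ?_⟩
  simp only [hθ.regMaxI_eq_integral, smul_eq_mul]
  rw [← integral_const_mul, ← integral_const_mul, ← integral_add
    ((hθ.integrable_ciSup _ _).const_mul _) ((hθ.integrable_ciSup _ _).const_mul _)]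
  refine integral_mono (hθ.integrable_ciSup _ _)
    (((hθ.integrable_ciSup _ _).const_mul _).add ((hθ.integrable_ciSup _ _).const_mul _))
    fun s => ?_
  cases isEmpty_or_nonempty ι
  · simp
  refine ciSup_le fun j => ?_
  have h₁ := le_ciSup (Set.finite_range fun j => t j + η j * s j).bddAbove j
  have h₂ := le_ciSup (Set.finite_range fun j => u j + η j * s j).bddAbove j
  calc (a • t + b • u) j + η j * s j
      = a * (t j + η j * s j) + b * (u j + η j * s j) := by
        simp only [Pi.add_apply, Pi.smul_apply, smul_eq_mul]
        linear_combination (-(η j * s j)) * hab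
    _ ≤ _ := by gcongr

theorem IsRegKernel.contDiff_regMaxI {θ : ℝ → ℝ} (hθ : IsRegKernel θ) {η : ι → ℝ}
    (hη : ∀ j, 0 < η j) : ContDiff ℝ ∞ (regMaxI θ η) := by
  set g : (ι → ℝ) → ℝ := fun s => ∏ j, θ (-s j)
  set f : (ι → ℝ) → ℝ := fun x => ⨆ j, η j * x j
  have hsmooth := hθ.smooth
  have hg : ContDiff ℝ ∞ g := contDiff_prod fun j _ => by fun_prop
  have hgs : HasCompactSupport g := by
    refine HasCompactSupport.intro (K := univ.pi fun _ => Icc (-1) 1)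
      (isCompact_univ_pi fun _ => isCompact_Icc) fun x hx => ?_
    obtain ⟨j, hj⟩ : ∃ j, x j ∉ Icc (-1 : ℝ) 1 := by
      simpa only [mem_univ_pi, not_forall] using hx
    refine Finset.prod_eq_zero (Finset.mem_univ j) ?_
    by_contra h
    have := hθ.supp h
    exact hj ⟨by linarith [this.2], by linarith [this.1]⟩
  have hf : LocallyIntegrable f :=
    (continuous_ciSup_of_fintype fun j => by fun_prop).locallyIntegrable
  have hconv := hgs.contDiff_convolution_left (ContinuousLinearMap.mul ℝ ℝ) hg hf
  have hlin : ContDiff ℝ ∞ fun t : ι → ℝ => fun j => t j / η j := by fun_prop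
  convert hconv.comp hlin using 1
  ext t
  rw [Function.comp_apply, convolution_def, ← integral_neg_eq_self, regMaxI]
  congr 1
  ext s
  simp only [g, f, ContinuousLinearMap.mul_apply', Pi.neg_apply, neg_neg,
    sub_neg_eq_add]
  rw [mul_comm]
  congr 1
  exact iSup_congr fun j => by
    have := (hη j).ne'
    simp only [Pi.add_apply]
    field_simp

end Fintype

/-- An index whose contribution is dominated on the whole support of the kernel may be dropped. -/
theorem IsRegKernel.regMaxI_eq_of_subset {κ : Type} {θ : ℝ → ℝ} (hθ : IsRegKernel θ)
    {A C : Finset κ} (hAC : A ⊆ C) (hA : A.Nonempty) {η : κ → ℝ} (hη : ∀ j, 0 < η j)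
    (t : C → ℝ) (ht : ∀ k : C, (k : κ) ∉ A → ∃ j : A,
      t k + η k ≤ t ⟨j, hAC j.2⟩ - η j) :
    regMaxI θ (fun j : C => η j) t =
      regMaxI θ (fun j : A => η j) (fun j => t ⟨j, hAC j.2⟩) := by
  have := hθ.isProbabilityMeasure
  have hA' : Nonempty A := hA.to_subtype
  have hC' : Nonempty C := (hA.mono hAC).to_subtype
  have hmap : Measure.pi (fun _ : A => kernelMeasure θ) =
      (Measure.pi fun _ : C => kernelMeasure θ).map (Finset.restrict₂ (π := fun _ => ℝ) hAC) :=
    isProjectiveMeasureFamily_pi (fun _ : κ => kernelMeasure θ) C A hAC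
  have hres : Measurable (Finset.restrict₂ (π := fun _ : κ => ℝ) hAC) :=
    Finset.measurable_restrict₂ hAC
  have hcont : Continuous fun s : A → ℝ => ⨆ j : A, (t ⟨j, hAC j.2⟩ + η j * s j) :=
    continuous_ciSup_of_fintype fun j => by fun_prop
  rw [hθ.regMaxI_eq_integral, hθ.regMaxI_eq_integral, hmap,
    integral_map hres.aemeasurable hcont.aestronglyMeasurable]
  refine integral_congr_ae ?_
  filter_upwards [hθ.ae_pi_abs_le_one (ι := C)] with s hs
  have hb := (Set.finite_range fun j : A =>
    t ⟨j, hAC j.2⟩ + η j * Finset.restrict₂ (π := fun _ => ℝ) hAC s j).bddAbove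
  refine le_antisymm (ciSup_le fun k => ?_) (ciSup_le fun j => ?_)
  · by_cases hk : (k : κ) ∈ A
    · exact le_ciSup hb ⟨k, hk⟩
    · obtain ⟨j, hj⟩ := ht k hk
      refine le_trans ?_ (le_ciSup hb j)
      have h₁ := (abs_le.1 (hs k)).2
      have h₂ := (abs_le.1 (hs ⟨j, hAC j.2⟩)).1
      simp only [Finset.restrict₂]
      nlinarith [hη k, hη j]
  · exact le_ciSup (Set.finite_range fun k : C => t k + η k * s k).bddAbove ⟨j, hAC j.2⟩

/-! ### Second-order conditions -/

theorem ConvexOn.fderiv_apply_le {E : Type*} [NormedAddCommGroup E] [NormedSpace ℝ E]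
    {f : E → ℝ} (hf : ConvexOn ℝ univ f) {x : E} (hd : DifferentiableAt ℝ f x) (y : E) :
    fderiv ℝ f x y ≤ f (x + y) - f x := by
  have hc : ConvexOn ℝ univ fun r : ℝ => f (AffineMap.lineMap x (x + y) r) := by
    have h := hf.comp_affineMap (AffineMap.lineMap x (x + y))
    rwa [preimage_univ] at h
  have hl : HasDerivAt (fun r : ℝ => f (AffineMap.lineMap x (x + y) r)) (fderiv ℝ f x y) 0 := by
    have h : HasDerivAt (AffineMap.lineMap x (x + y) : ℝ → E) y 0 := by
      simpa using AffineMap.hasDerivAt_lineMap (a := x) (b := x + y) (x := (0 : ℝ))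
    refine HasFDerivAt.comp_hasDerivAt (0 : ℝ) ?_ h
    simpa using hd.hasFDerivAt
  simpa [slope] using hc.le_slope_of_hasDerivAt (mem_univ 0) (mem_univ 1) one_pos hl

theorem IsLocalMin.iteratedFDeriv_two_nonneg {E : Type*} [NormedAddCommGroup E]
    [NormedSpace ℝ E] {f : E → ℝ} {x : E} (hmin : IsLocalMin f x) (hf : ContDiffAt ℝ 2 f x)
    (w : E) : 0 ≤ iteratedFDeriv ℝ 2 f x ![w, w] := by
  have hline (r : ℝ) : HasDerivAt (fun r : ℝ => x + r • w) w r := by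
    simpa using ((hasDerivAt_id r).smul_const w).const_add x
  have hcont : Tendsto (fun r : ℝ => x + r • w) (𝓝 0) (𝓝 x) := by
    simpa using (hline 0).continuousAt.tendsto
  have hderiv : deriv (fun r : ℝ => f (x + r • w)) =ᶠ[𝓝 0]
      fun r : ℝ => fderiv ℝ f (x + r • w) w := by
    have hnear : ∀ᶠ y in 𝓝 x, ContDiffAt ℝ 2 f y := hf.eventually (by simp)
    filter_upwards [hcont.eventually hnear] with r hr
    exact ((hr.differentiableAt two_ne_zero).hasFDerivAt.comp_hasDerivAt r (hline r)).deriv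
  have hsecond : deriv (deriv fun r : ℝ => f (x + r • w)) 0 =
      iteratedFDeriv ℝ 2 f x ![w, w] := by
    rw [hderiv.deriv_eq, iteratedFDeriv_two_apply]
    have h : HasFDerivAt (fderiv ℝ f) (fderiv ℝ (fderiv ℝ f) x) (x + (0 : ℝ) • w) := by
      simpa using ((hf.fderiv_right (m := 1) le_rfl).differentiableAt one_ne_zero).hasFDerivAt
    have h' : HasDerivAt (fun r : ℝ => fderiv ℝ f (x + r • w)) (fderiv ℝ (fderiv ℝ f) x w) 0 :=
      h.comp_hasDerivAt (0 : ℝ) (hline 0)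
    exact ((ContinuousLinearMap.apply ℝ ℝ w).hasFDerivAt.comp_hasDerivAt (0 : ℝ) h').deriv
  have hmin' : IsLocalMin (fun r : ℝ => f (x + r • w)) 0 := by
    filter_upwards [hcont.eventually hmin] with r hr
    simpa using hr
  by_contra! hneg
  rw [← hsecond] at hneg
  have hmax := isLocalMax_of_deriv_deriv_neg hneg hmin'.deriv_eq_zero
    (ContinuousAt.comp (g := f) (by simpa using hf.continuousAt) (hline 0).continuousAt)
  have hconst : (fun r : ℝ => f (x + r • w)) =ᶠ[𝓝 0] fun _ => f (x + (0 : ℝ) • w) := by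
    filter_upwards [hmin', hmax] with r h₁ h₂ using le_antisymm h₂ h₁
  rw [hconst.deriv.deriv_eq] at hneg
  simp at hneg

theorem IsRegKernel.le_leviForm_regMaxI {n : ℕ} {ι : Type} [Fintype ι] [Nonempty ι]
    {θ : ℝ → ℝ} (hθ : IsRegKernel θ) {η : ι → ℝ} (hη : ∀ j, 0 < η j)
    {u : ι → EuclideanSpace ℂ (Fin n) → ℝ} {z w : EuclideanSpace ℂ (Fin n)} {c : ℝ}
    (hu : ∀ j, ContDiffAt ℝ 2 (u j) z) (hc : ∀ j, c ≤ leviForm (u j) z w) :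
    c ≤ leviForm (fun y => regMaxI θ η fun j => u j y) z w := by
  classical
  set M := regMaxI θ η
  have hM : ContDiff ℝ 2 M := (hθ.contDiff_regMaxI hη).of_le (by norm_cast)
  set t : ι → ℝ := fun j => u j z
  set L := fderiv ℝ M t
  have hsub (y : ι → ℝ) : L y ≤ M (t + y) - M t :=
    (hθ.convexOn_regMaxI η).fderiv_apply_le (hM.differentiable two_ne_zero t) y
  have hLsum (y : ι → ℝ) : L y = ∑ j, L (Pi.single j 1) * y j := by
    conv_lhs => rw [pi_eq_sum_univ' y]
    simp [map_sum, mul_comm]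
  have hLnonneg (j : ι) : 0 ≤ L (Pi.single j 1) := by
    have h := hsub (-Pi.single j 1)
    have hmono : M (t + -Pi.single j 1) ≤ M t := hθ.regMaxI_mono η fun i => by
      have : (0 : ι → ℝ) i ≤ Pi.single (M := fun _ => ℝ) j 1 i :=
        Pi.single_nonneg.2 zero_le_one i
      simpa using this
    rw [map_neg] at h
    linarith
  have hLone : ∑ j, L (Pi.single j 1) = 1 := by
    have h (r : ℝ) : (∑ j, L (Pi.single j 1)) * r ≤ r := by
      have h := hsub fun _ => r
      rw [hLsum, ← Finset.sum_mul] at h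
      have h' : M (t + fun _ => r) = M t + r := hθ.regMaxI_add_const η t r
      linarith
    linarith [h 1, h (-1)]
  set ℓ : EuclideanSpace ℂ (Fin n) → ℝ := ∑ j, L (Pi.single j 1) • u j
  have hℓ_apply (y) : ℓ y = L fun j => u j y := by
    rw [hLsum]
    simp [ℓ]
  have hsmul (j : ι) : ContDiffAt ℝ 2 (L (Pi.single j 1) • u j) z :=
    ContDiffAt.const_smul (L (Pi.single j 1)) (hu j)
  have hℓ : ContDiffAt ℝ 2 ℓ z := by
    have := ContDiffAt.sum (s := Finset.univ) fun j _ => hsmul j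
    convert this using 1
    ext y
    simp [ℓ]
  have hMu : ContDiffAt ℝ 2 (fun y => M fun j => u j y) z :=
    hM.contDiffAt.comp z (contDiffAt_pi.2 hu)
  have hℓ_levi : leviForm ℓ z w = ∑ j, L (Pi.single j 1) * leviForm (u j) z w := by
    simp only [leviForm, ℓ]
    rw [iteratedFDeriv_sum_apply fun j _ => hsmul j]
    simp only [iteratedFDeriv_const_smul_apply (hu _), sum_apply,
      smul_apply, smul_eq_mul, ← Finset.sum_add_distrib, mul_add]
  have hmin : IsLocalMin ((fun y => M fun j => u j y) - ℓ) z := by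
    refine Eventually.of_forall fun y => ?_
    have h := hsub ((fun j => u j y) - t)
    rw [map_sub, add_sub_cancel, ← hℓ_apply] at h
    have ht : ℓ z = L t := hℓ_apply z
    simp only [Pi.sub_apply]
    change M t - ℓ z ≤ _
    linarith
  have hD (v) := hmin.iteratedFDeriv_two_nonneg (hMu.sub hℓ) v
  rw [iteratedFDeriv_sub_apply hMu hℓ] at hD
  simp only [sub_apply, sub_nonneg] at hD
  calc c = ∑ j, L (Pi.single j 1) * c := by rw [← Finset.sum_mul, hLone, one_mul]
    _ ≤ ∑ j, L (Pi.single j 1) * leviForm (u j) z w :=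
        Finset.sum_le_sum fun j _ => mul_le_mul_of_nonneg_left (hc j) (hLnonneg j)
    _ = leviForm ℓ z w := hℓ_levi.symm
    _ ≤ _ := add_le_add (hD _) (hD _)

/-! ### Gluing smooth functions with matching derivatives -/

section Gluing

variable {E F : Type*} [NormedAddCommGroup E] [NormedSpace ℝ E] [NormedAddCommGroup F]
  [NormedSpace ℝ F]

theorem HasFDerivWithinAt.biUnion_finset {κ : Type*} {f : E → F} {f' : E →L[ℝ] F} {x : E}
    {S : Finset κ} {s : κ → Set E} (h : ∀ c ∈ S, HasFDerivWithinAt f f' (s c) x) :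
    HasFDerivWithinAt f f' (⋃ c ∈ S, s c) x := by
  classical
  induction S using Finset.induction_on with
  | empty => simp
  | insert a S _ ih =>
    rw [Finset.set_biUnion_insert]
    exact (h a (Finset.mem_insert_self a S)).union
      (ih fun c hc => h c (Finset.mem_insert_of_mem hc))

/-- A function that selects, at each point of an open set, one of finitely many smooth functions
is smooth provided that at each point all the functions selected nearby have the same derivatives. -/
theorem hasFTaylorSeriesUpToOn_of_selection {κ : Type*} {U : Set E} (hU : IsOpen U)
    {f : κ → E → F} {sel : E → κ} {S : Finset κ} (hsel : ∀ z ∈ U, sel z ∈ S)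
    (hf : ∀ c ∈ S, ContDiffOn ℝ ∞ (f c) U)
    (hagree : ∀ z ∈ U, ∀ c ∈ S, z ∈ closure (U ∩ sel ⁻¹' {c}) → ∀ m : ℕ,
      iteratedFDeriv ℝ m (f c) z = iteratedFDeriv ℝ m (f (sel z)) z) :
    HasFTaylorSeriesUpToOn ∞ (fun z => f (sel z) z)
      (fun z => ftaylorSeries ℝ (f (sel z)) z) U := by
  rw [hasFTaylorSeriesUpToOn_top_iff' le_rfl]
  refine ⟨fun z _ => rfl, fun m z hz => ?_⟩
  have hcover : U ⊆ ⋃ c ∈ S, U ∩ sel ⁻¹' {c} := fun y hy =>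
    mem_iUnion₂.2 ⟨sel y, hsel y hy, hy, rfl⟩
  refine (HasFDerivWithinAt.biUnion_finset fun c hc => ?_).mono hcover
  by_cases hcl : z ∈ closure (U ∩ sel ⁻¹' {c})
  · have hag := hagree z hz c hc hcl
    have hd : HasFDerivAt (iteratedFDeriv ℝ m (f c))
        (iteratedFDeriv ℝ (m + 1) (f c) z).curryLeft z := by
      have hfz : ContDiffAt ℝ ∞ (f c) z := (hf c hc).contDiffAt (hU.mem_nhds hz)
      have := (hfz.differentiableAt_iteratedFDeriv (m := m) (by norm_cast; simp)).hasFDerivAt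
      rwa [fderiv_iteratedFDeriv] at this
    rw [hag (m + 1)] at hd
    exact hd.hasFDerivWithinAt.congr
      (fun y hy => by have : sel y = c := hy.2; simp only [ftaylorSeries, this])
      (hag m).symm
  · exact HasFDerivWithinAt.of_notMem_closure hcl

/-- All derivatives of `g` vanish on the closure of an open set where `g` vanishes. -/
theorem ContDiff.iteratedFDeriv_eq_zero_of_mem_closure {g : E → F} (hg : ContDiff ℝ ∞ g)
    {W : Set E} (hW : IsOpen W) (hgW : ∀ y ∈ W, g y = 0) {y : E} (hy : y ∈ closure W) (m : ℕ) :
    iteratedFDeriv ℝ m g y = 0 := by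
  have hcl : IsClosed {y | iteratedFDeriv ℝ m g y = 0} :=
    isClosed_eq (hg.continuous_iteratedFDeriv (by norm_cast; exact le_top)) continuous_const
  refine closure_minimal (fun v hv => ?_) hcl hy
  have : g =ᶠ[𝓝 v] fun _ => 0 := by
    filter_upwards [hW.mem_nhds hv] with v' hv' using hgW v' hv'
  have h := this.iteratedFDeriv ℝ m
  rw [mem_ofPred_eq, h.self_of_nhds]
  simp

theorem iteratedFDeriv_comp_eq_zero {G : Type*} [NormedAddCommGroup G] [NormedSpace ℝ G]
    {g : F → G} {f : E → F} {x : E} (hg : ContDiff ℝ ∞ g) (hf : ContDiffAt ℝ ∞ f x)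
    (h : ∀ m : ℕ, iteratedFDeriv ℝ m g (f x) = 0) (m : ℕ) :
    iteratedFDeriv ℝ m (g ∘ f) x = 0 := by
  have hm : ((m : ℕ) : ℕ∞ω) ≤ ∞ := by norm_cast; exact le_top
  obtain ⟨u, hu, hfu⟩ := (hf.of_le hm).contDiffOn le_rfl (by simp)
  obtain ⟨U, hUu, hU, hxU⟩ := mem_nhds_iff.1 (by simpa using hu)
  have hfU := hfu.mono hUu
  set D : ℝ := 1 + ∑ i ∈ Finset.range (m + 1), ‖iteratedFDerivWithin ℝ i f U x‖
  have hD (i) (h₁ : 1 ≤ i) (hi : i ≤ m) : ‖iteratedFDerivWithin ℝ i f U x‖ ≤ D ^ i := by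
    have hle : ‖iteratedFDerivWithin ℝ i f U x‖ ≤ D :=
      (Finset.single_le_sum (f := fun i => ‖iteratedFDerivWithin ℝ i f U x‖)
        (fun _ _ => norm_nonneg _) (Finset.mem_range.2 (Nat.lt_succ_of_le hi))).trans
        (le_add_of_nonneg_left zero_le_one)
    have hD₁ : 1 ≤ D := le_add_of_nonneg_right (Finset.sum_nonneg fun _ _ => norm_nonneg _)
    exact hle.trans (le_self_pow₀ hD₁ (by lia))
  have hle := norm_iteratedFDerivWithin_comp_le (hg.of_le hm).contDiffOn hfU le_rfl
    uniqueDiffOn_univ hU.uniqueDiffOn (mapsTo_univ _ _) hxU (C := 0)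
    (fun i _ => by rw [iteratedFDerivWithin_univ, h i, norm_zero]) hD
  rw [iteratedFDerivWithin_of_isOpen m hU hxU] at hle
  simpa using hle

end Gluing

/-- Dropping an index that is dominated at `z` does not change any derivative at `z` of a
regularized maximum, even if the domination fails at points near `z`. -/
theorem IsRegKernel.iteratedFDeriv_regMaxI_eq {E : Type*} [NormedAddCommGroup E]
    [NormedSpace ℝ E] {κ : Type} {θ : ℝ → ℝ} (hθ : IsRegKernel θ) {A C : Finset κ} (hAC : A ⊆ C)
    (hA : A.Nonempty) {η : κ → ℝ} (hη : ∀ j, 0 < η j) {u : κ → E → ℝ} {z : E}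
    (hu : ∀ j ∈ C, ContDiffAt ℝ ∞ (u j) z)
    (hdom : ∀ k ∈ C, k ∉ A → ∃ j ∈ A, u k z + η k ≤ u j z - η j) (m : ℕ) :
    iteratedFDeriv ℝ m (fun y => regMaxI θ (fun j : C => η j) fun j : C => u j y) z =
      iteratedFDeriv ℝ m (fun y => regMaxI θ (fun j : A => η j) fun j : A => u j y) z := by
  classical
  have hMC : ContDiff ℝ ∞ (regMaxI θ fun j : C => η j) := hθ.contDiff_regMaxI fun j => hη j
  have hMA : ContDiff ℝ ∞ (regMaxI θ fun j : A => η j) := hθ.contDiff_regMaxI fun j => hη j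
  have hres : ContDiff ℝ ∞ fun (t : C → ℝ) (j : A) => t ⟨j, hAC j.2⟩ := by fun_prop
  set Φ : E → C → ℝ := fun y j => u j y
  have hΦ : ContDiffAt ℝ ∞ Φ z := contDiffAt_pi.2 fun j => hu j j.2
  set g : (C → ℝ) → ℝ := (regMaxI θ fun j : C => η j) -
    (regMaxI θ fun j : A => η j) ∘ fun (t : C → ℝ) (j : A) => t ⟨j, hAC j.2⟩
  have hg : ContDiff ℝ ∞ g := hMC.sub (hMA.comp hres)
  set W : Set (C → ℝ) := ⋂ k : C, {t | (k : κ) ∉ A →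
    ∃ j : A, t k + η k < t ⟨j, hAC j.2⟩ - η j}
  have hW : IsOpen W := by
    refine isOpen_iInter_of_finite fun k => ?_
    by_cases hk : (k : κ) ∈ A
    · simp [hk]
    · simp only [hk, not_false_eq_true, true_imp_iff, ofPred_exists]
      exact isOpen_iUnion fun j => isOpen_lt (by fun_prop) (by fun_prop)
  have hgW : ∀ t ∈ W, g t = 0 := fun t ht => by
    refine sub_eq_zero.2 (hθ.regMaxI_eq_of_subset hAC hA hη t fun k hk => ?_)
    obtain ⟨j, hj⟩ := mem_iInter.1 ht k hk
    exact ⟨j, hj.le⟩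
  have hcl : Φ z ∈ closure W := by
    set e : C → ℝ := fun j => if (j : κ) ∈ A then 1 else 0
    have hlim : Tendsto (fun r : ℝ => Φ z + r • e) (𝓝[>] 0) (𝓝 (Φ z)) := by
      have : Continuous fun r : ℝ => Φ z + r • e := by fun_prop
      simpa using (this.tendsto 0).mono_left nhdsWithin_le_nhds
    refine mem_closure_of_tendsto hlim ?_
    filter_upwards [self_mem_nhdsWithin] with r hr
    refine mem_iInter.2 fun k hk => ?_
    obtain ⟨j, hj, hjk⟩ := hdom k k.2 hk
    refine ⟨⟨j, hj⟩, ?_⟩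
    have hr' : 0 < r := hr
    simp only [Pi.add_apply, Pi.smul_apply, smul_eq_mul, e, hk, hj, if_true, if_false, Φ]
    linarith
  have hzero := iteratedFDeriv_comp_eq_zero hg hΦ
    (hg.iteratedFDeriv_eq_zero_of_mem_closure hW hgW hcl) m
  have hm : ((m : ℕ) : ℕ∞ω) ≤ ∞ := by norm_cast; exact le_top
  have hC' : ContDiffAt ℝ m (fun y => regMaxI θ (fun j : C => η j) fun j : C => u j y) z :=
    (hMC.contDiffAt.comp z hΦ).of_le hm
  have hA' : ContDiffAt ℝ m (fun y => regMaxI θ (fun j : A => η j) fun j : A => u j y) z :=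
    ((hMA.comp hres).contDiffAt.comp z hΦ).of_le hm
  rw [← sub_eq_zero, ← iteratedFDeriv_sub_apply hC' hA']
  exact hzero

/-- the gluing lemma for `α`-plurisubharmonic functions: given a locally
finite cover `{Ω_j}` of the open set `X` by relatively compact open sets, smooth
`α`-plurisubharmonic functions `φ_j` near `closure (Ω j)`, and `η_j > 0` satisfying the
boundary compatibility conditions, the regularized maximum
`φ̃(z) = M_{(η_j)_{j ∈ J z}}((φ_j z)_{j ∈ J z})`, `J z = {j : z ∈ Ω j}`, is well-defined,
smooth and `α`-plurisubharmonic on `X`. -/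
theorem stmt10 (n : ℕ) (hn : 1 ≤ n)
    (X : Set (EuclideanSpace ℂ (Fin n))) (hX : IsOpen X)
    (α : EuclideanSpace ℂ (Fin n) → EuclideanSpace ℂ (Fin n) → ℝ)
    (hαcont : ContinuousOn (fun p : EuclideanSpace ℂ (Fin n) × EuclideanSpace ℂ (Fin n) =>
      α p.1 p.2) (X ×ˢ Set.univ))
    (hαquad : ∀ x ∈ X, ∃ Q : QuadraticForm ℝ (EuclideanSpace ℂ (Fin n)),
      ∀ w, α x w = Q w)
    (hαI : ∀ x ∈ X, ∀ w, α x (Complex.I • w) = α x w)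
    (Ω : ℕ → Set (EuclideanSpace ℂ (Fin n)))
    (hΩopen : ∀ j, IsOpen (Ω j))
    (hΩcomp : ∀ j, IsCompact (closure (Ω j)))
    (hΩX : ∀ j, closure (Ω j) ⊆ X)
    (hcover : X ⊆ ⋃ j, Ω j)
    (hlocfin : ∀ x ∈ X, ∃ V ∈ nhds x, {j | (Ω j ∩ V).Nonempty}.Finite)
    (φ : ℕ → EuclideanSpace ℂ (Fin n) → ℝ)
    (hφ : ∀ j, ∃ N : Set (EuclideanSpace ℂ (Fin n)), IsOpen N ∧ closure (Ω j) ⊆ N ∧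
      ContDiffOn ℝ (⊤ : ℕ∞) (φ j) N)
    (hφpsh : ∀ j, ∀ x ∈ Ω j, ∀ w : EuclideanSpace ℂ (Fin n),
      0 ≤ leviForm (φ j) x w + α x w)
    (η : ℕ → ℝ) (hη : ∀ j, 0 < η j)
    (hbd1 : ∀ k, ∀ z ∈ frontier (Ω k), φ k z < ⨆ j : {j // z ∈ Ω j}, φ j z)
    (hbd2 : ∀ k, ∀ z ∈ frontier (Ω k),
      φ k z + η k ≤ ⨆ j : {j // z ∈ Ω j}, (φ j z - η j))
    (θ : ℝ → ℝ) (hθ : IsRegKernel θ) :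
    ∃ φt : EuclideanSpace ℂ (Fin n) → ℝ,
      (∀ z ∈ X, (∃ s : Finset ℕ, ∀ j, j ∈ s ↔ z ∈ Ω j) ∧
        ∀ s : Finset ℕ, (∀ j, j ∈ s ↔ z ∈ Ω j) → s.Nonempty ∧
          φt z = regMaxI θ (fun j : s => η (j : ℕ)) (fun j : s => φ (j : ℕ) z)) ∧
      ContDiffOn ℝ (⊤ : ℕ∞) φt X ∧
      ∀ x ∈ X, ∀ w : EuclideanSpace ℂ (Fin n), 0 ≤ leviForm φt x w + α x w := by
  classical
  choose N hNopen hNsub hNsmooth using hφ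
  have hfin : ∀ z ∈ X, {j | z ∈ Ω j}.Finite := fun z hz => by
    obtain ⟨V, hV, hVfin⟩ := hlocfin z hz
    exact hVfin.subset fun j hj => ⟨z, hj, mem_of_mem_nhds hV⟩
  set J : EuclideanSpace ℂ (Fin n) → Finset ℕ := fun z =>
    if h : {j | z ∈ Ω j}.Finite then h.toFinset else ∅
  have hJ : ∀ z ∈ X, ∀ j, j ∈ J z ↔ z ∈ Ω j := fun z hz j => by simp [J, hfin z hz]
  have hJne : ∀ z ∈ X, (J z).Nonempty := fun z hz => by
    obtain ⟨j, hj⟩ := mem_iUnion.1 (hcover hz)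
    exact ⟨j, (hJ z hz j).2 hj⟩
  set f : Finset ℕ → EuclideanSpace ℂ (Fin n) → ℝ := fun c y =>
    regMaxI θ (fun j : c => η j) fun j : c => φ j y
  have hdom : ∀ z ∈ X, ∀ k, z ∈ frontier (Ω k) → ∃ j ∈ J z, φ k z + η k ≤ φ j z - η j := by
    intro z hz k hk
    have : Finite {j // z ∈ Ω j} := hfin z hz
    obtain ⟨j, hj⟩ := hJne z hz
    have : Nonempty {j // z ∈ Ω j} := ⟨j, (hJ z hz j).1 hj⟩
    obtain ⟨i, hi⟩ := exists_eq_ciSup_of_finite (f := fun j : {j // z ∈ Ω j} => φ j z - η j)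
    exact ⟨i, (hJ z hz i).2 i.2, (hbd2 k z hk).trans_eq hi.symm⟩
  have hlocal : ∀ z₀ ∈ X, ∃ U, IsOpen U ∧ z₀ ∈ U ∧
      HasFTaylorSeriesUpToOn ∞ (fun z => f (J z) z) (fun z => ftaylorSeries ℝ (f (J z)) z) U := by
    intro z₀ hz₀
    obtain ⟨V, hV, hVfin⟩ := hlocfin z₀ hz₀
    set U := (X ∩ interior V) ∩ ⋂ j ∈ hVfin.toFinset,
      if z₀ ∈ closure (Ω j) then N j else (closure (Ω j))ᶜ
    have hU : IsOpen U := by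
      refine (hX.inter isOpen_interior).inter (isOpen_biInter_finset fun j _ => ?_)
      split_ifs
      exacts [hNopen j, isClosed_closure.isOpen_compl]
    have hz₀U : z₀ ∈ U := by
      refine ⟨⟨hz₀, mem_interior_iff_mem_nhds.2 hV⟩, mem_iInter₂.2 fun j _ => ?_⟩
      split_ifs with h
      exacts [hNsub j h, h]
    set S := hVfin.toFinset.filter fun j => z₀ ∈ closure (Ω j)
    have hUN : ∀ z ∈ U, ∀ j ∈ S, z ∈ N j := fun z hz j hj => by
      have h := mem_iInter₂.1 hz.2 j (Finset.mem_filter.1 hj).1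
      rwa [if_pos (Finset.mem_filter.1 hj).2] at h
    have hJS : ∀ z ∈ U, J z ⊆ S := fun z hz j hj => by
      have hzj := (hJ z hz.1.1 j).1 hj
      have hjV : j ∈ hVfin.toFinset :=
        hVfin.mem_toFinset.2 ⟨z, hzj, interior_subset hz.1.2⟩
      refine Finset.mem_filter.2 ⟨hjV, ?_⟩
      by_contra h
      have h' := mem_iInter₂.1 hz.2 j hjV
      rw [if_neg h] at h'
      exact h' (subset_closure hzj)
    have hsmooth : ∀ z ∈ U, ∀ j ∈ S, ContDiffAt ℝ ∞ (φ j) z := fun z hz j hj =>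
      (hNsmooth j).contDiffAt ((hNopen j).mem_nhds (hUN z hz j hj))
    refine ⟨U, hU, hz₀U, hasFTaylorSeriesUpToOn_of_selection hU (S := S.powerset)
      (fun z hz => Finset.mem_powerset.2 (hJS z hz)) (fun c hc z hz => ?_) ?_⟩
    · have hφc : ContDiffAt ℝ ∞ (fun y (j : c) => φ j y) z :=
        contDiffAt_pi.2 fun j => hsmooth z hz j (Finset.mem_powerset.1 hc j.2)
      exact ((hθ.contDiff_regMaxI fun j : c => hη j).contDiffAt.comp z hφc).contDiffWithinAt
    · intro z hz c hc hcl m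
      refine hθ.iteratedFDeriv_regMaxI_eq (fun j hj => ?_) (hJne z hz.1.1) hη
        (fun j hj => hsmooth z hz j (Finset.mem_powerset.1 hc hj)) (fun k hk hkz => ?_) m
      · obtain ⟨y, hyj, hyU, hyc⟩ := mem_closure_iff.1 hcl _ (hΩopen j) ((hJ z hz.1.1 j).1 hj)
        have hyc' : J y = c := hyc
        exact hyc' ▸ (hJ y hyU.1.1 j).2 hyj
      · refine hdom z hz.1.1 k ?_
        rw [(hΩopen k).frontier_eq]
        refine ⟨closure_mono ?_ hcl, fun h => hkz ((hJ z hz.1.1 k).2 h)⟩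
        rintro y ⟨hyU, hyc⟩
        have hyc' : J y = c := hyc
        exact (hJ y hyU.1.1 k).1 (hyc' ▸ hk)
  refine ⟨fun z => f (J z) z, fun z hz => ⟨⟨J z, hJ z hz⟩, fun s hs => ?_⟩, fun z hz => ?_,
    fun z hz w => ?_⟩
  · obtain rfl : s = J z := Finset.ext fun j => (hs j).trans (hJ z hz j).symm
    exact ⟨hJne z hz, rfl⟩
  · obtain ⟨U, hU, hzU, hser⟩ := hlocal z hz
    exact (hser.contDiffOn.contDiffAt (hU.mem_nhds hzU)).contDiffWithinAt
  · obtain ⟨U, hU, hzU, hser⟩ := hlocal z hz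
    have hD : iteratedFDeriv ℝ 2 (f (J z)) z = iteratedFDeriv ℝ 2 (fun y => f (J y) y) z := by
      exact (hser.eq_iteratedFDerivWithin_of_uniqueDiffOn (m := 2) (by norm_cast)
        hU.uniqueDiffOn hzU).trans (iteratedFDerivWithin_of_isOpen 2 hU hzU)
    have : Nonempty (J z) := (hJne z hz).to_subtype
    have hlevi : -α z w ≤ leviForm (f (J z)) z w := by
      refine hθ.le_leviForm_regMaxI (fun j : J z => hη j) (fun j => ?_) fun j => ?_
      all_goals have hj := (hJ z hz j).1 j.2
      · exact ((hNsmooth j).contDiffAt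
          ((hNopen j).mem_nhds (hNsub j (subset_closure hj)))).of_le (by norm_cast)
      · linarith [hφpsh j z hj w]
    have heq : leviForm (fun y => f (J y) y) z w = leviForm (f (J z)) z w := by
      simp only [leviForm, hD]
    linarith
end
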